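/- arXiv:1605.07982 — 7 statements merged into one kernel-verified Lean document; each statement's English description precedes it below -/
import Mathlib

section
/- Let G be a digraph on vertex set V = A ∪ B (A, B disjoint, B nonempty) with no self-loops, containing a reverse directed spanning tree, such that A is an isolated node set (every edge starting in A ends in A) and the induced subgraph on B is strongly connected; fix weights a_{ij} > 0. Suppose there exists l ≥ 0 such that for every gain k1 > l the rendezvous set of the A-subsystem is globally asymptotically stable for the A-subsystem Σ_A (which is an autonomous system since A is isolated): for every ε > 0 there is δ > 0 such that every solution of Σ_A with D_A(x(0)) < δ satisfies D_A(x(t)) < ε on its interval of existence, every maximal solution of Σ_A exists on [0,∞), and D_A(x(t)) → 0 along every such solution, where D_A(x) = max_{i,j∈A}‖x_i − x_j‖. Then there exists k1* ≥ l such that for every k1 > k1*, the rendezvous set of the full system is globally asymptotically stable: for every ε > 0 there is δ > 0 such that every solution of the closed-loop system on V with D(x(0)) < δ satisfies D(x(t)) < ε on its interval of existence, every maximal solution exists on [0,∞), and D(x(t)) → 0 as t → ∞, where D(x) = max_{i,j∈V}‖x_i − x_j‖. -/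
open Matrix
open scoped BigOperators ENNReal

/-- The rotation matrix `R(θ)`. -/
noncomputable def rotM (θ : ℝ) : Matrix (Fin 2) (Fin 2) ℝ :=
  !![Real.cos θ, -Real.sin θ; Real.sin θ, Real.cos θ]

/-- Euclidean norm on ℝ². -/
noncomputable def enorm2 (v : Fin 2 → ℝ) : ℝ :=
  Real.sqrt (v 0 ^ 2 + v 1 ^ 2)

/-- The linear consensus vector field `f_i(x) = Σ_{j∈N_i} a_{ij}(x_j - x_i)`. -/
noncomputable def fcons {n : ℕ} (Adj : Fin n → Fin n → Bool) (a : Fin n → Fin n → ℝ)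
    (x : Fin n → Fin 2 → ℝ) (i : Fin n) : Fin 2 → ℝ :=
  ∑ j : Fin n, if Adj i j = true then a i j • (x j - x i) else 0

/-- The linear speed feedback `u_i = ‖f_i(x)‖ · (R(θᵢ)⁻¹ f_i(x)) · e1`. -/
noncomputable def uFB {n : ℕ} (Adj : Fin n → Fin n → Bool) (a : Fin n → Fin n → ℝ)
    (x : Fin n → Fin 2 → ℝ) (θi : ℝ) (i : Fin n) : ℝ :=
  enorm2 (fcons Adj a x i) * (((rotM θi)⁻¹ *ᵥ fcons Adj a x i) 0)

/-- The angular speed feedback `ω_i = -k1 (R(θᵢ)⁻¹ f_i(x)) · e2`. -/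
noncomputable def omegaFB {n : ℕ} (k1 : ℝ) (Adj : Fin n → Fin n → Bool)
    (a : Fin n → Fin n → ℝ) (x : Fin n → Fin 2 → ℝ) (θi : ℝ) (i : Fin n) : ℝ :=
  -k1 * (((rotM θi)⁻¹ *ᵥ fcons Adj a x i) 1)

/-- `(x, θ)` is a solution on `[0, T)` of the closed-loop subsystem `Σ_S`
associated with the node set `S`. -/
def IsSolOnSub {n : ℕ} (Adj : Fin n → Fin n → Bool) (a : Fin n → Fin n → ℝ) (k1 : ℝ)
    (S : Finset (Fin n)) (x : ℝ → Fin n → Fin 2 → ℝ) (θ : ℝ → Fin n → ℝ)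
    (T : ℝ≥0∞) : Prop :=
  ∀ t : ℝ, 0 ≤ t → ENNReal.ofReal t < T → ∀ i ∈ S,
    HasDerivWithinAt (fun s => x s i)
      (uFB Adj a (x t) (θ t i) i • (rotM (θ t i) *ᵥ ![1, 0])) (Set.Ici 0) t ∧
    HasDerivWithinAt (fun s => θ s i) (omegaFB k1 Adj a (x t) (θ t i) i) (Set.Ici 0) t

/-- A maximal solution of the subsystem `Σ_S`. -/
def IsMaxSolSub {n : ℕ} (Adj : Fin n → Fin n → Bool) (a : Fin n → Fin n → ℝ) (k1 : ℝ)
    (S : Finset (Fin n)) (x : ℝ → Fin n → Fin 2 → ℝ) (θ : ℝ → Fin n → ℝ)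
    (T : ℝ≥0∞) : Prop :=
  IsSolOnSub Adj a k1 S x θ T ∧
    ∀ (x' : ℝ → Fin n → Fin 2 → ℝ) (θ' : ℝ → Fin n → ℝ) (T' : ℝ≥0∞),
      T < T' → IsSolOnSub Adj a k1 S x' θ' T' →
        ¬(∀ t : ℝ, 0 ≤ t → ENNReal.ofReal t < T →
            ∀ i ∈ S, x' t i = x t i ∧ θ' t i = θ t i)

/-- `D_S(x) = max_{i,j ∈ S} ‖x_i - x_j‖`. -/
noncomputable def DmaxSub {n : ℕ} (S : Finset (Fin n)) (x : Fin n → Fin 2 → ℝ) : ℝ :=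
  ⨆ i : S, ⨆ j : S, enorm2 (x i - x j)

/-- Global asymptotic stability of the rendezvous set of `Σ_S`: stability, and
completeness plus global attractivity for every maximal solution. -/
def RendezvousGAS {n : ℕ} (Adj : Fin n → Fin n → Bool) (a : Fin n → Fin n → ℝ)
    (k1 : ℝ) (S : Finset (Fin n)) : Prop :=
  (∀ ε : ℝ, 0 < ε → ∃ δ : ℝ, 0 < δ ∧
    ∀ (x : ℝ → Fin n → Fin 2 → ℝ) (θ : ℝ → Fin n → ℝ) (T : ℝ≥0∞),
      IsSolOnSub Adj a k1 S x θ T → DmaxSub S (x 0) < δ →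
        ∀ t : ℝ, 0 ≤ t → ENNReal.ofReal t < T → DmaxSub S (x t) < ε) ∧
  (∀ (x : ℝ → Fin n → Fin 2 → ℝ) (θ : ℝ → Fin n → ℝ) (T : ℝ≥0∞),
      IsMaxSolSub Adj a k1 S x θ T →
        T = ⊤ ∧ Filter.Tendsto (fun t => DmaxSub S (x t)) Filter.atTop (nhds 0))

/-- A differentiable function whose derivative is negative on the level `L` stays below `L`. -/
theorem le_level_of_deriv_neg {V V' : ℝ → ℝ} {a b L : ℝ}
    (hV : ∀ t ∈ Set.Icc a b, HasDerivWithinAt V (V' t) (Set.Ici a) t)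
    (ha : V a ≤ L) (hneg : ∀ t ∈ Set.Icc a b, V t = L → V' t < 0) :
    ∀ t ∈ Set.Icc a b, V t ≤ L := by
  have hcont : ContinuousOn V (Set.Icc a b) := fun t ht =>
    (hV t ht).continuousWithinAt.mono fun s hs => hs.1
  exact image_le_of_deriv_right_lt_deriv_boundary (B := fun _ => L) (B' := fun _ => 0) hcont
    (fun t ht => (hV t ⟨ht.1, ht.2.le⟩).mono (Set.Ici_subset_Ici.2 ht.1)) ha
    (fun t => hasDerivAt_const t L) fun t ht h => hneg t ⟨ht.1, ht.2.le⟩ h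

/-- A differentiable function on a half line that decreases at a definite rate as long as it is at
least `L` is eventually at most `L`. -/
theorem eventually_le_level_of_deriv_le_neg {V V' : ℝ → ℝ} {a L κ : ℝ} (hκ : 0 < κ)
    (hV : ∀ t, a ≤ t → HasDerivWithinAt V (V' t) (Set.Ici a) t)
    (hneg : ∀ t, a ≤ t → L ≤ V t → V' t ≤ -κ) :
    ∀ᶠ t in Filter.atTop, V t ≤ L := by
  obtain ⟨s, has, hs⟩ : ∃ s, a ≤ s ∧ V s ≤ L := by
    by_contra! hgt
    set b := a + (V a - L) / κ + 1 with hb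
    have hab : a ≤ b := by
      have : 0 ≤ (V a - L) / κ := div_nonneg (by linarith [hgt a le_rfl]) hκ.le
      linarith
    have hcont : ContinuousOn V (Set.Icc a b) := fun t ht =>
      (hV t ht.1).continuousWithinAt.mono fun s hs => hs.1
    have key := image_le_of_deriv_right_le_deriv_boundary
      (B := fun t => V a - κ * (t - a)) (B' := fun _ => -κ) hcont
      (fun t ht => (hV t ht.1).mono (Set.Ici_subset_Ici.2 ht.1)) (by simp)
      (by fun_prop)
      (fun t _ => by
        have := ((((hasDerivAt_id t).sub_const a).const_mul κ).const_sub (V a)).hasDerivWithinAt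
          (s := Set.Ici t)
        simpa using this)
      (fun t ht => hneg t ht.1 (hgt t ht.1).le) (Set.right_mem_Icc.2 hab)
    have h1 : κ * (b - a) = V a - L + κ := by rw [hb]; field_simp; ring
    have h2 := hgt b hab
    linarith
  filter_upwards [Filter.eventually_ge_atTop s] with t ht
  exact le_level_of_deriv_neg (a := s) (b := t) (V' := V')
    (fun r hr => (hV r (has.trans hr.1)).mono (Set.Ici_subset_Ici.2 has)) hs
    (fun r hr h => (hneg r (has.trans hr.1) h.ge).trans_lt (neg_neg_of_pos hκ)) t ⟨ht, le_rfl⟩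

/-- A solution of an autonomous locally Lipschitz differential equation along which the vector field
is bounded can be continued beyond a finite time. -/
theorem exists_extension_of_bounded {H : Type*} [NormedAddCommGroup H] [NormedSpace ℝ H]
    [CompleteSpace H] {F : H → H} (hF : LocallyLipschitz F) {z : ℝ → H} {τ M : ℝ} (hτ : 0 < τ)
    (hz : ∀ t, 0 ≤ t → t < τ → HasDerivWithinAt z (F (z t)) (Set.Ici 0) t)
    (hM : ∀ t, 0 ≤ t → t < τ → ‖F (z t)‖ ≤ M) :
    ∃ (z' : ℝ → H) (τ' : ℝ), τ < τ' ∧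
      (∀ t, 0 ≤ t → t < τ' → HasDerivWithinAt z' (F (z' t)) (Set.Ici 0) t) ∧
      ∀ t, t < τ → z' t = z t := by
  have hM0 : 0 ≤ M := (norm_nonneg _).trans (hM 0 le_rfl hτ)
  have hlip : LipschitzOnWith M.toNNReal z (Set.Ico 0 τ) :=
    (convex_Ico 0 τ).lipschitzOnWith_of_nnnorm_hasDerivWithin_le
      (fun t ht => (hz t ht.1 ht.2).mono fun s hs => hs.1) fun t ht => by
        rw [← NNReal.coe_le_coe, Real.coe_toNNReal M hM0]
        exact hM t ht.1 ht.2
  have hIco : Set.Ico 0 τ ∈ nhdsWithin τ (Set.Iio τ) := Ico_mem_nhdsLT hτ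
  obtain ⟨y, hy⟩ : ∃ y, Filter.Tendsto z (nhdsWithin τ (Set.Iio τ)) (nhds y) := by
    apply cauchy_map_iff_exists_tendsto.1
    have hc : Cauchy (nhdsWithin τ (Set.Iio τ)) := cauchy_nhds.mono inf_le_left
    have := hlip.uniformContinuousOn
    exact hc.map_of_le this (Filter.le_principal_iff.2 hIco)
  obtain ⟨K, s, hs, hl⟩ := hF y
  obtain ⟨a, ha, has⟩ := Metric.mem_nhds_iff.1 hs
  set L : ℝ := K * a + ‖F y‖ + 1 with hL
  have hL0 : 0 < L := by positivity
  have hb : ∀ p ∈ Metric.closedBall y (a / 2), ‖F p‖ ≤ L := fun p hp => by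
    have h1 : ‖F p - F y‖ ≤ K * ‖p - y‖ := hl.norm_sub_le
      (has (Metric.closedBall_subset_ball (half_lt_self ha) hp)) (mem_of_mem_nhds hs)
    have h2 : ‖p - y‖ ≤ a := (mem_closedBall_iff_norm.1 hp).trans (half_le_self ha.le)
    have h3 : K * ‖p - y‖ ≤ K * a := by gcongr
    have h4 := norm_le_norm_sub_add (F p) (F y)
    linarith
  set ε : ℝ := a / L / 4 with hε
  have hε0 : 0 < ε := by positivity
  have hPL : IsPicardLindelof (fun _ => F) (tmin := τ - ε) (tmax := τ + ε)
      ⟨τ, by simp [hε0.le]⟩ y (.mk (a / 2) (half_pos ha).le) 0 (.mk L hL0.le) K := by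
    apply IsPicardLindelof.of_time_independent hb
    · exact hl.mono ((Metric.closedBall_subset_ball (half_lt_self ha)).trans has)
    · have : L * ε ≤ a / 2 := by rw [hε]; field_simp; norm_num
      simpa using this
  obtain ⟨α, hα0, hα⟩ := hPL.exists_eq_forall_mem_Icc_hasDerivWithinAt₀
  simp only at hα0
  set z' : ℝ → H := fun t => if t < τ then z t else α t with hz'
  have hlt : ∀ t, t < τ → z' t = z t := fun t ht => if_pos ht
  have hge : ∀ t, τ ≤ t → z' t = α t := fun t ht => if_neg ht.not_gt
  have hz'τ : z' τ = y := (hge τ le_rfl).trans hα0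
  have hderiv_lt : ∀ t, 0 ≤ t → t < τ → HasDerivWithinAt z' (F (z' t)) (Set.Ici 0) t := by
    intro t h0 ht
    rw [hlt t ht]
    refine (hz t h0 ht).congr_of_eventuallyEq ?_ (hlt t ht)
    filter_upwards [nhdsWithin_le_nhds (Iio_mem_nhds ht)] with r hr using hlt r hr
  refine ⟨z', τ + ε, by linarith, ?_, hlt⟩
  intro t h0 ht
  rcases lt_trichotomy t τ with h | h | h
  · exact hderiv_lt t h0 h
  · subst h
    have hat : ∀ r ∈ Set.Ioo 0 t, HasDerivAt z' (F (z' r)) r := fun r hr =>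
      (hderiv_lt r hr.1.le hr.2).hasDerivAt (Ici_mem_nhds hr.1)
    have hIoo : Set.Ioo 0 t ∈ nhdsWithin t (Set.Iio t) := Ioo_mem_nhdsLT hτ
    have htend : Filter.Tendsto z' (nhdsWithin t (Set.Iio t)) (nhds y) :=
      hy.congr' (by filter_upwards [self_mem_nhdsWithin] with r hr using (hlt r hr).symm)
    have hleft : HasDerivWithinAt z' (F (z' t)) (Set.Iic t) t := by
      refine hasDerivWithinAt_Iic_of_tendsto_deriv (s := Set.Ioo 0 t)
        (fun r hr => (hat r hr).differentiableAt.differentiableWithinAt) ?_ hIoo ?_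
      · rw [ContinuousWithinAt, hz'τ]
        exact htend.mono_left (nhdsWithin_mono _ fun r hr => hr.2)
      · rw [hz'τ]
        refine ((hF.continuous.tendsto y).comp htend).congr' ?_
        filter_upwards [hIoo] with r hr using (hat r hr).deriv.symm
    have hright : HasDerivWithinAt z' (F (z' t)) (Set.Icc t (t + ε)) t := by
      rw [hge t le_rfl]
      exact ((hα t ⟨by linarith, by linarith⟩).mono
        (Set.Icc_subset_Icc (by linarith) le_rfl)).congr (fun r hr => hge r hr.1) (hge t le_rfl)
    have hunion := hleft.union hright
    rw [Set.Iic_union_Icc_eq_Iic (by linarith)] at hunion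
    exact (hunion.hasDerivAt (Iic_mem_nhds (by linarith))).hasDerivWithinAt
  · have h1 : HasDerivAt α (F (α t)) t :=
      (hα t ⟨by linarith, ht.le⟩).hasDerivAt (Icc_mem_nhds (by linarith) ht)
    rw [hge t h.le]
    refine (h1.congr_of_eventuallyEq ?_).hasDerivWithinAt
    filter_upwards [Ioi_mem_nhds h] with r hr using hge r (le_of_lt hr)

/-- The weighted Laplacian of a strongly connected digraph has a positive left null vector. -/
theorem exists_pos_left_null {ι : Type*} [Fintype ι] [Nonempty ι] {m : ι → ι → ℝ}
    (hm : ∀ i j, 0 ≤ m i j) (hsc : ∀ i j, Relation.ReflTransGen (fun p q => 0 < m p q) i j) :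
    ∃ γ : ι → ℝ, (∀ i, 0 < γ i) ∧ ∀ j, ∑ i, γ i * m i j = γ j * ∑ k, m j k := by
  classical
  set L : Matrix ι ι ℝ := Matrix.diagonal (fun i => ∑ k, m i k) - Matrix.of m with hL
  have hdet : L.det = 0 := by
    refine Matrix.exists_mulVec_eq_zero_iff.1 ⟨fun _ => 1, ?_, ?_⟩
    · intro h
      simpa using congrFun h (Classical.arbitrary ι)
    · ext i
      simp [hL, Matrix.mulVec, dotProduct, Matrix.diagonal_apply]
  obtain ⟨v, hv0, hv⟩ := Matrix.exists_vecMul_eq_zero_iff.2 hdet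
  have hnull : ∀ j, ∑ i, v i * m i j = v j * ∑ k, m j k := fun j => by
    have := congrFun hv j
    simp only [hL, Matrix.vecMul_sub, Matrix.vecMul_diagonal, Pi.sub_apply, Pi.zero_apply] at this
    have h2 : Matrix.vecMul v (Matrix.of m) j = ∑ i, v i * m i j := rfl
    linarith
  have hle : ∀ j, |v j| * ∑ k, m j k ≤ ∑ i, |v i| * m i j := fun j => by
    calc |v j| * ∑ k, m j k = |v j * ∑ k, m j k| := by
          rw [abs_mul, abs_of_nonneg (Finset.sum_nonneg fun k _ => hm j k)]
      _ = |∑ i, v i * m i j| := by rw [hnull]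
      _ ≤ ∑ i, |v i * m i j| := Finset.abs_sum_le_sum_abs _ _
      _ = ∑ i, |v i| * m i j := by simp_rw [abs_mul, abs_of_nonneg (hm _ _)]
  have hsum : ∑ j, |v j| * ∑ k, m j k = ∑ j, ∑ i, |v i| * m i j := by
    rw [Finset.sum_comm]
    simp_rw [Finset.mul_sum]
  have heq : ∀ j, |v j| * ∑ k, m j k = ∑ i, |v i| * m i j := fun j =>
    (Finset.sum_eq_sum_iff_of_le fun j _ => hle j).1 hsum j (Finset.mem_univ j)
  have hback : ∀ i j, 0 < m i j → v j = 0 → v i = 0 := fun i j hij hj => by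
    have h0 : ∑ i, |v i| * m i j = 0 := by rw [← heq j, hj]; simp
    have h1 := (Finset.sum_eq_zero_iff_of_nonneg
      fun i _ => mul_nonneg (abs_nonneg (v i)) (hm i j)).1 h0 i (Finset.mem_univ i)
    rcases mul_eq_zero.1 h1 with h | h
    · exact abs_eq_zero.1 h
    · exact absurd h hij.ne'
  refine ⟨fun i => |v i|, fun j => abs_pos.2 fun hj => hv0 ?_, fun j => (heq j).symm⟩
  ext i
  induction hsc i j using Relation.ReflTransGen.head_induction_on with
  | refl => exact hj
  | head h _ ih => exact hback _ _ h ih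

section Dissipation

open scoped InnerProductSpace

variable {ι E : Type*} [Fintype ι] [NormedAddCommGroup E]

/-- The quadratic form of the symmetrized, weighted and grounded Laplacian with edge weights `m`,
node weights `γ` and grounding weights `d`. -/
noncomputable def groundedForm (m : ι → ι → ℝ) (d γ : ι → ℝ) (w : ι → E) : ℝ :=
  ∑ i, ∑ j, γ i * m i j / 2 * ‖w j - w i‖ ^ 2 + ∑ i, γ i * d i * ‖w i‖ ^ 2

theorem groundedForm_nonneg {m : ι → ι → ℝ} {d γ : ι → ℝ} (hm : ∀ i j, 0 ≤ m i j)
    (hd : ∀ i, 0 ≤ d i) (hγ : ∀ i, 0 < γ i) (w : ι → E) : 0 ≤ groundedForm m d γ w :=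
  add_nonneg
    (Finset.sum_nonneg fun i _ => Finset.sum_nonneg fun j _ =>
      mul_nonneg (div_nonneg (mul_nonneg (hγ i).le (hm i j)) zero_le_two) (sq_nonneg _))
    (Finset.sum_nonneg fun i _ => mul_nonneg (mul_nonneg (hγ i).le (hd i)) (sq_nonneg _))

/-- If the grounded form vanishes, the vector is constant, and it is zero at grounded nodes. -/
theorem eq_of_groundedForm_eq_zero {m : ι → ι → ℝ} {d γ : ι → ℝ} (hm : ∀ i j, 0 ≤ m i j)
    (hsc : ∀ i j, Relation.ReflTransGen (fun p q => 0 < m p q) i j)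
    (hd : ∀ i, 0 ≤ d i) (hγ : ∀ i, 0 < γ i) {w : ι → E} (hw : groundedForm m d γ w = 0) :
    (∀ i j, w i = w j) ∧ ∀ i, d i ≠ 0 → w i = 0 := by
  have hn1 : ∀ i j, 0 ≤ γ i * m i j / 2 * ‖w j - w i‖ ^ 2 := fun i j =>
    mul_nonneg (div_nonneg (mul_nonneg (hγ i).le (hm i j)) zero_le_two) (sq_nonneg _)
  have hn2 : ∀ i, 0 ≤ γ i * d i * ‖w i‖ ^ 2 := fun i =>
    mul_nonneg (mul_nonneg (hγ i).le (hd i)) (sq_nonneg _)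
  obtain ⟨h1, h2⟩ := (add_eq_zero_iff_of_nonneg
    (Finset.sum_nonneg fun i _ => Finset.sum_nonneg fun j _ => hn1 i j)
    (Finset.sum_nonneg fun i _ => hn2 i)).1 hw
  have hedge : ∀ i j, 0 < m i j → w i = w j := fun i j hij => by
    have h3 := (Finset.sum_eq_zero_iff_of_nonneg
      fun i _ => Finset.sum_nonneg fun j _ => hn1 i j).1 h1 i (Finset.mem_univ i)
    have h4 := (Finset.sum_eq_zero_iff_of_nonneg fun j _ => hn1 i j).1 h3 j (Finset.mem_univ j)
    have h5 : γ i * m i j / 2 ≠ 0 := by have := hγ i; positivity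
    have h6 : ‖w j - w i‖ = 0 := by simpa [h5] using h4
    exact (sub_eq_zero.1 (norm_eq_zero.1 h6)).symm
  constructor
  · intro i j
    induction hsc i j with
    | refl => rfl
    | tail _ h ih => exact ih.trans (hedge _ _ h)
  · intro i hi
    have h3 := (Finset.sum_eq_zero_iff_of_nonneg fun i _ => hn2 i).1 h2 i (Finset.mem_univ i)
    simpa [hi, (hγ i).ne'] using h3

variable [InnerProductSpace ℝ E]

theorem sum_inner_laplacian_eq_neg_groundedForm {m : ι → ι → ℝ} {d γ : ι → ℝ}
    (hγ : ∀ j, ∑ i, γ i * m i j = γ j * ∑ k, m j k) (w : ι → E) :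
    ∑ i, γ i * ⟪w i, ∑ j, m i j • (w j - w i) - d i • w i⟫_ℝ = -groundedForm m d γ w := by
  have h1 : ∀ i j, ⟪w i, w j - w i⟫_ℝ
      = -(‖w j - w i‖ ^ 2 / 2) + (‖w j‖ ^ 2 / 2 - ‖w i‖ ^ 2 / 2) := fun i j => by
    rw [norm_sub_sq_real, inner_sub_right, real_inner_self_eq_norm_sq, real_inner_comm]
    ring
  have h2 : ∑ i, ∑ j, γ i * m i j * (‖w j‖ ^ 2 / 2 - ‖w i‖ ^ 2 / 2) = 0 := by
    simp_rw [mul_sub, Finset.sum_sub_distrib]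
    rw [Finset.sum_comm]
    simp_rw [← Finset.sum_mul, hγ, Finset.mul_sum]
    simp
  simp_rw [inner_sub_right, inner_sum, real_inner_smul_right, real_inner_self_eq_norm_sq, h1,
    mul_sub, Finset.mul_sum, Finset.sum_sub_distrib, mul_add, Finset.sum_add_distrib,
    ← mul_assoc]
  rw [h2, groundedForm]
  have h3 : ∀ i j, γ i * m i j * -(‖w j - w i‖ ^ 2 / 2) = -(γ i * m i j / 2 * ‖w j - w i‖ ^ 2) :=
    fun i j => by ring
  simp_rw [h3, Finset.sum_neg_distrib]
  ring

theorem norm_smul_self_injective : Function.Injective fun v : E => ‖v‖ • v := by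
  intro u v h
  simp only at h
  have hn : ‖u‖ = ‖v‖ := by
    have := congrArg norm h
    simp only [norm_smul, norm_norm] at this
    exact (mul_self_inj (norm_nonneg _) (norm_nonneg _)).1 this
  rcases eq_or_ne ‖v‖ 0 with h0 | h0
  · rw [norm_eq_zero.1 h0, norm_eq_zero.1 (hn.trans h0)]
  · rw [hn] at h
    exact smul_right_injective E h0 h

/-- Coercivity of the grounded form along `w i = ‖f i‖ • f i`. In the ungrounded case the vector `f`
must have zero weighted mean. -/
theorem exists_coercive_groundedForm [FiniteDimensional ℝ E] {m : ι → ι → ℝ} {d γ : ι → ℝ}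
    (hm : ∀ i j, 0 ≤ m i j) (hsc : ∀ i j, Relation.ReflTransGen (fun p q => 0 < m p q) i j)
    (hd : ∀ i, 0 ≤ d i) (hγ : ∀ i, 0 < γ i) :
    ∃ c : ℝ, 0 < c ∧ ∀ f : ι → E, ((∀ i, d i = 0) → ∑ i, γ i • f i = 0) →
      c * ∑ i, ‖f i‖ ^ 4 ≤ groundedForm m d γ fun i => ‖f i‖ • f i := by
  set K : Set (ι → E) := Metric.sphere 0 1 ∩ {f | (∀ i, d i = 0) → ∑ i, γ i • f i = 0} with hK
  have hKc : IsCompact K := by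
    refine (isCompact_sphere 0 1).inter_right ?_
    by_cases h : ∀ i, d i = 0
    · simp only [h, implies_true, forall_const]
      exact isClosed_eq (by fun_prop) continuous_const
    · simp [h]
  set Q : (ι → E) → ℝ := fun f => groundedForm m d γ fun i => ‖f i‖ • f i with hQ
  have hQc : Continuous Q := by
    rw [hQ]
    unfold groundedForm
    fun_prop
  have hpos : ∀ f ∈ K, 0 < Q f := by
    rintro f ⟨hf1, hf2⟩
    refine lt_of_le_of_ne (groundedForm_nonneg hm hd hγ _) fun h0 => ?_
    obtain ⟨he, hz⟩ := eq_of_groundedForm_eq_zero hm hsc hd hγ h0.symm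
    have hfe : ∀ i j, f i = f j := fun i j => norm_smul_self_injective (he i j)
    have hf0 : f = 0 := by
      ext i
      by_cases h : ∀ i, d i = 0
      · have h1 : (∑ j, γ j) • f i = 0 := by
          rw [Finset.sum_smul, ← hf2 h]
          exact Finset.sum_congr rfl fun j _ => by rw [hfe i j]
        have h2 : 0 < ∑ j, γ j := Finset.sum_pos (fun j _ => hγ j) ⟨i, Finset.mem_univ i⟩
        exact (smul_eq_zero.1 h1).resolve_left h2.ne'
      · push Not at h
        obtain ⟨j, hj⟩ := h
        have := hz j hj
        have h3 : f j = 0 := norm_smul_self_injective (by simpa using this)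
        rw [hfe i j, h3]; rfl
    simp [hf0] at hf1
  obtain ⟨c, hc, hcK⟩ : ∃ c : ℝ, 0 < c ∧ ∀ f ∈ K, c ≤ Q f := by
    rcases K.eq_empty_or_nonempty with h | h
    · exact ⟨1, one_pos, by simp [h]⟩
    · obtain ⟨f, hf, hmin⟩ := hKc.exists_isMinOn h hQc.continuousOn
      exact ⟨Q f, hpos f hf, fun g hg => hmin hg⟩
  have hhom : ∀ (r : ℝ) (f : ι → E), 0 ≤ r → Q (r • f) = r ^ 4 * Q f := by
    intro r f hr
    have h1 : ∀ i, ‖(r • f) i‖ • (r • f) i = r ^ 2 • (‖f i‖ • f i) := fun i => by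
      simp only [Pi.smul_apply, norm_smul, Real.norm_of_nonneg hr, smul_smul]
      congr 1; ring
    simp only [hQ, groundedForm, h1, ← smul_sub, norm_smul (r ^ 2), mul_add, Finset.mul_sum]
    congr 1
    · refine Finset.sum_congr rfl fun i _ => Finset.sum_congr rfl fun j _ => ?_
      rw [Real.norm_of_nonneg (sq_nonneg r)]; ring
    · refine Finset.sum_congr rfl fun i _ => ?_
      rw [Real.norm_of_nonneg (sq_nonneg r)]; ring
  refine ⟨c / (Fintype.card ι + 1), by positivity, fun f hf => ?_⟩
  have hsum : ∑ i, ‖f i‖ ^ 4 ≤ (Fintype.card ι + 1) * ‖f‖ ^ 4 := by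
    calc ∑ i, ‖f i‖ ^ 4 ≤ ∑ _i : ι, ‖f‖ ^ 4 :=
          Finset.sum_le_sum fun i _ => pow_le_pow_left₀ (norm_nonneg _) (norm_le_pi_norm f i) 4
      _ = Fintype.card ι * ‖f‖ ^ 4 := by simp
      _ ≤ _ := by gcongr; linarith
  have hmain : c * ‖f‖ ^ 4 ≤ Q f := by
    rcases eq_or_ne f 0 with h | h
    · rw [h, norm_zero, zero_pow four_ne_zero, mul_zero]
      exact groundedForm_nonneg hm hd hγ _
    · have hn : 0 < ‖f‖ := norm_pos_iff.2 h
      have hmem : ‖f‖⁻¹ • f ∈ K := by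
        refine ⟨by simp [norm_smul, hn.ne'], fun h0 => ?_⟩
        simp only [Pi.smul_apply, smul_comm _ ‖f‖⁻¹, ← Finset.smul_sum, hf h0, smul_zero]
      have h1 := hcK _ hmem
      rw [hhom _ _ (inv_nonneg.2 hn.le)] at h1
      calc c * ‖f‖ ^ 4 ≤ ‖f‖⁻¹ ^ 4 * Q f * ‖f‖ ^ 4 := by gcongr
        _ = Q f := by field_simp
  calc c / (Fintype.card ι + 1) * ∑ i, ‖f i‖ ^ 4
      ≤ c / (Fintype.card ι + 1) * ((Fintype.card ι + 1) * ‖f‖ ^ 4) := by gcongr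
    _ = c * ‖f‖ ^ 4 := by field_simp
    _ ≤ Q f := hmain

theorem norm_laplacian_le {m : ι → ι → ℝ} {d : ι → ℝ} (hm : ∀ i j, 0 ≤ m i j)
    (hd : ∀ i, 0 ≤ d i) {u : ι → E} {r : ℝ} (hu : ∀ i, ‖u i‖ ≤ r) (i : ι) :
    ‖∑ j, m i j • (u j - u i) - d i • u i‖ ≤ (∑ i, (∑ j, 2 * m i j + d i)) * r := by
  have hr : 0 ≤ r := (norm_nonneg _).trans (hu i)
  calc ‖∑ j, m i j • (u j - u i) - d i • u i‖
      ≤ ∑ j, ‖m i j • (u j - u i)‖ + ‖d i • u i‖ :=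
        (norm_sub_le _ _).trans (add_le_add_left (norm_sum_le _ _) _)
    _ ≤ ∑ j, 2 * m i j * r + d i * r := by
        gcongr with j
        · rw [norm_smul, Real.norm_of_nonneg (hm i j)]
          have : ‖u j - u i‖ ≤ r + r := (norm_sub_le _ _).trans (add_le_add (hu j) (hu i))
          nlinarith [hm i j]
        · rw [norm_smul, Real.norm_of_nonneg (hd i)]
          gcongr
          exacts [hd i, hu i]
    _ = (∑ j, 2 * m i j + d i) * r := by rw [add_mul, Finset.sum_mul]
    _ ≤ (∑ i, (∑ j, 2 * m i j + d i)) * r := by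
        gcongr
        exact Finset.single_le_sum (f := fun i => ∑ j, 2 * m i j + d i)
          (fun k _ => add_nonneg
            (Finset.sum_nonneg fun j _ => mul_nonneg zero_le_two (hm k j)) (hd k))
          (Finset.mem_univ i)

theorem le_sqrt_sum_sq {r : ι → ℝ} (i : ι) : r i ≤ √(∑ j, r j ^ 2) :=
  Real.le_sqrt_of_sq_le
    (Finset.single_le_sum (f := fun j => r j ^ 2) (fun _ _ => sq_nonneg _) (Finset.mem_univ i))

/-- The scalar estimate absorbing the cross terms of the Lyapunov derivative. -/
theorem absorb_cross_terms {c G N C μ k p e η : ℝ} (hc : 0 < c) (hμ : 0 < μ)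
    (hμ1 : μ ≤ 1) (hμc : 3 * N * μ * C ≤ c / 4) (hN : 0 ≤ N) (hp : 0 ≤ p) (hη : 0 ≤ η)
    (hk : (G * C) ^ 2 / (c * μ) ≤ k) :
    -(c * p ^ 2) + G * (p * (C * e)) + G * (p * η) + μ * (3 * N * (p * (C * p + η)) - k * e ^ 2)
      ≤ -(c / 4) * p ^ 2 + (G + 3 * N) ^ 2 / c * η ^ 2 := by
  have h1 : G * (p * (C * e)) ≤ c / 4 * p ^ 2 + (G * C) ^ 2 / c * e ^ 2 := by
    have h : 0 ≤ (c * p / 2 - G * C * e) ^ 2 / c := by positivity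
    have h' : (c * p / 2 - G * C * e) ^ 2 / c
        = c / 4 * p ^ 2 + (G * C) ^ 2 / c * e ^ 2 - G * (p * (C * e)) := by field_simp; ring
    linarith
  have h2 : (G + 3 * N) * (p * η) ≤ c / 4 * p ^ 2 + (G + 3 * N) ^ 2 / c * η ^ 2 := by
    have h : 0 ≤ (c * p / 2 - (G + 3 * N) * η) ^ 2 / c := by positivity
    have h' : (c * p / 2 - (G + 3 * N) * η) ^ 2 / c
        = c / 4 * p ^ 2 + (G + 3 * N) ^ 2 / c * η ^ 2 - (G + 3 * N) * (p * η) := by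
      field_simp; ring
    linarith
  have h3 : (G * C) ^ 2 / c * e ^ 2 ≤ μ * k * e ^ 2 := by
    gcongr
    calc (G * C) ^ 2 / c = μ * ((G * C) ^ 2 / (c * μ)) := by field_simp
      _ ≤ μ * k := by gcongr
  have h4 : 3 * N * μ * C * p ^ 2 ≤ c / 4 * p ^ 2 := by gcongr
  have h5 : μ * (3 * N * (p * η)) ≤ 3 * N * (p * η) :=
    mul_le_of_le_one_left (by positivity) hμ1
  nlinarith

/-- The pointwise dissipation inequality. For a unicycle with heading frame `(b i, bp i)` and
reference `f i`, the right-hand side of the summand is the time derivative of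
`γ i / 3 * ‖f i‖ ^ 3 + μ * (‖f i‖ ^ 2 * ⟪f i, b i⟫)`. -/
theorem exists_dissipation [FiniteDimensional ℝ E] {m : ι → ι → ℝ} {d γ : ι → ℝ}
    (hm : ∀ i j, 0 ≤ m i j) (hsc : ∀ i j, Relation.ReflTransGen (fun p q => 0 < m p q) i j)
    (hd : ∀ i, 0 ≤ d i) (hγ : ∀ i, 0 < γ i)
    (hnull : ∀ j, ∑ i, γ i * m i j = γ j * ∑ k, m j k) :
    ∃ μ k0 c C : ℝ, 0 < μ ∧ 0 < c ∧ 0 ≤ C ∧ (∀ i, μ ≤ γ i / 6) ∧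
      ∀ (k : ℝ) (f b bp g h : ι → E), k0 ≤ k → ((∀ i, d i = 0) → ∑ i, γ i • f i = 0) →
        (∀ i, ‖b i‖ = 1) → (∀ i, ‖bp i‖ = 1) →
        (∀ i, f i = ⟪f i, b i⟫_ℝ • b i + ⟪f i, bp i⟫_ℝ • bp i) →
        (∀ i, g i = ∑ j, m i j • ((‖f j‖ * ⟪f j, b j⟫_ℝ) • b j - (‖f i‖ * ⟪f i, b i⟫_ℝ) • b i)
          - d i • (‖f i‖ * ⟪f i, b i⟫_ℝ) • b i + h i) →
        ∑ i, (γ i * (‖f i‖ * ⟪f i, g i⟫_ℝ) + μ * (2 * ⟪f i, g i⟫_ℝ * ⟪f i, b i⟫_ℝ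
          + ‖f i‖ ^ 2 * (⟪g i, b i⟫_ℝ + -k * ⟪f i, bp i⟫_ℝ * ⟪f i, bp i⟫_ℝ)))
          ≤ -c * ∑ i, ‖f i‖ ^ 4 + C * ∑ i, ‖h i‖ ^ 2 := by
  obtain ⟨c, hc, hcoer⟩ := exists_coercive_groundedForm (E := E) hm hsc hd hγ
  set C := ∑ i, (∑ j, 2 * m i j + d i) with hC
  set G := ∑ i, γ i with hG
  set N : ℝ := (Fintype.card ι : ℝ) with hN
  have hC0 : 0 ≤ C := Finset.sum_nonneg fun k _ => add_nonneg
    (Finset.sum_nonneg fun j _ => mul_nonneg zero_le_two (hm k j)) (hd k)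
  have hN0 : 0 ≤ N := Nat.cast_nonneg _
  obtain ⟨μ₁, hμ₁, hμ₁γ⟩ : ∃ μ₁ : ℝ, 0 < μ₁ ∧ ∀ i, μ₁ ≤ γ i / 6 := by
    rcases isEmpty_or_nonempty ι with h | h
    · exact ⟨1, one_pos, fun i => h.elim i⟩
    · obtain ⟨i₀, hi₀⟩ := Finite.exists_min γ
      exact ⟨γ i₀ / 6, by have := hγ i₀; positivity, fun i => by linarith [hi₀ i]⟩
  set μ := min (min μ₁ 1) (c / (12 * (N * C + 1))) with hμ
  have hNC : 0 ≤ N * C := mul_nonneg hN0 hC0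
  have hμ0 : 0 < μ := lt_min (lt_min hμ₁ one_pos) (by positivity)
  have hμ1 : μ ≤ 1 := (min_le_left _ _).trans (min_le_right _ _)
  have hμc : 3 * N * μ * C ≤ c / 4 := by
    have h1 : μ * (12 * (N * C + 1)) ≤ c := (le_div_iff₀ (by positivity)).1 (min_le_right _ _)
    nlinarith
  refine ⟨μ, (G * C) ^ 2 / (c * μ), c / 4, (G + 3 * N) ^ 2 / c, hμ0, by positivity, by positivity,
    fun i => ((min_le_left _ _).trans (min_le_left _ _)).trans (hμ₁γ i), ?_⟩
  intro k f b bp g h hk hmean hb hbp hdecomp hg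
  set v : ι → E := fun i => (‖f i‖ * ⟪f i, b i⟫_ℝ) • b i with hv
  set e : ι → E := fun i => (‖f i‖ * ⟪f i, bp i⟫_ℝ) • bp i with he
  set w : ι → E := fun i => ‖f i‖ • f i with hw
  set p := √(∑ i, (‖f i‖ ^ 2) ^ 2) with hp
  set ε := √(∑ i, ‖e i‖ ^ 2) with hε
  set η := √(∑ i, ‖h i‖ ^ 2) with hη
  have hvwe : ∀ i, v i = w i - e i := fun i => by
    rw [eq_sub_iff_add_eq]
    simp only [hv, he, hw, mul_smul]
    rw [← smul_add, ← hdecomp i]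
  have hfp : ∀ i, ‖f i‖ ^ 2 ≤ p := fun i => le_sqrt_sum_sq (r := fun i => ‖f i‖ ^ 2) i
  have hwn : ∀ i, ‖w i‖ = ‖f i‖ ^ 2 := fun i => by
    simp only [hw, norm_smul, norm_norm]; ring
  have hfb : ∀ i, |⟪f i, b i⟫_ℝ| ≤ ‖f i‖ := fun i => by
    simpa [hb i] using abs_real_inner_le_norm (f i) (b i)
  have hvn : ∀ i, ‖v i‖ ≤ p := fun i => by
    refine le_trans ?_ (hfp i)
    simp only [hv, norm_smul, norm_mul, hb i, mul_one, Real.norm_eq_abs, abs_norm]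
    nlinarith [hfb i, norm_nonneg (f i)]
  have hen : ∀ i, ‖e i‖ ≤ ε := fun i => le_sqrt_sum_sq (r := fun i => ‖e i‖) i
  have hhn : ∀ i, ‖h i‖ ≤ η := fun i => le_sqrt_sum_sq (r := fun i => ‖h i‖) i
  have hgv : ∀ i, g i = (∑ j, m i j • (v j - v i) - d i • v i) + h i := hg
  have hgn : ∀ i, ‖g i‖ ≤ C * p + η := fun i => by
    rw [hgv]
    exact (norm_add_le _ _).trans (add_le_add (norm_laplacian_le hm hd hvn i) (hhn i))
  have hgw : ∀ i, g i = (∑ j, m i j • (w j - w i) - d i • w i)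
      - (∑ j, m i j • (e j - e i) - d i • e i) + h i := fun i => by
    rw [hgv]
    simp only [hvwe, smul_sub, Finset.sum_sub_distrib]
    abel
  have hε2 : ε ^ 2 = ∑ i, ‖f i‖ ^ 2 * (⟪f i, bp i⟫_ℝ * ⟪f i, bp i⟫_ℝ) := by
    rw [hε, Real.sq_sqrt (Finset.sum_nonneg fun _ _ => sq_nonneg _)]
    refine Finset.sum_congr rfl fun i _ => ?_
    simp only [he, norm_smul, norm_mul, hbp i, mul_one, mul_pow, Real.norm_eq_abs,
      sq_abs]
    ring
  have hp2 : p ^ 2 = ∑ i, ‖f i‖ ^ 4 := by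
    rw [hp, Real.sq_sqrt (Finset.sum_nonneg fun _ _ => sq_nonneg _)]
    exact Finset.sum_congr rfl fun i _ => by ring
  have hη2 : η ^ 2 = ∑ i, ‖h i‖ ^ 2 :=
    Real.sq_sqrt (Finset.sum_nonneg fun _ _ => sq_nonneg _)
  have hp0 : 0 ≤ p := Real.sqrt_nonneg _
  have hη0 : 0 ≤ η := Real.sqrt_nonneg _
  have hfirst : ∑ i, γ i * (‖f i‖ * ⟪f i, g i⟫_ℝ)
      ≤ -(c * p ^ 2) + G * (p * (C * ε)) + G * (p * η) := by
    have h1 : ∀ i, γ i * (‖f i‖ * ⟪f i, g i⟫_ℝ)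
        ≤ γ i * ⟪w i, ∑ j, m i j • (w j - w i) - d i • w i⟫_ℝ
          + γ i * (p * (C * ε)) + γ i * (p * η) := fun i => by
      have h2 : ‖f i‖ * ⟪f i, g i⟫_ℝ = ⟪w i, ∑ j, m i j • (w j - w i) - d i • w i⟫_ℝ
          - ⟪w i, ∑ j, m i j • (e j - e i) - d i • e i⟫_ℝ + ⟪w i, h i⟫_ℝ := by
        rw [← inner_sub_right, ← inner_add_right, ← hgw i, hw, real_inner_smul_left]
      have h3 : -⟪w i, ∑ j, m i j • (e j - e i) - d i • e i⟫_ℝ ≤ p * (C * ε) :=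
        (neg_le_abs _).trans ((abs_real_inner_le_norm _ _).trans
          (mul_le_mul ((hwn i).le.trans (hfp i)) (norm_laplacian_le hm hd hen i)
            (norm_nonneg _) hp0))
      have h4 : ⟪w i, h i⟫_ℝ ≤ p * η :=
        (real_inner_le_norm _ _).trans
          (mul_le_mul ((hwn i).le.trans (hfp i)) (hhn i) (norm_nonneg _) hp0)
      have h5 := hγ i
      rw [h2, ← mul_add, ← mul_add]
      gcongr
      linarith
    refine (Finset.sum_le_sum fun i _ => h1 i).trans ?_
    rw [Finset.sum_add_distrib, Finset.sum_add_distrib, ← Finset.sum_mul, ← Finset.sum_mul,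
      sum_inner_laplacian_eq_neg_groundedForm hnull]
    have := hcoer f hmean
    rw [← hp2] at this
    linarith
  have hsecond : ∑ i, (2 * ⟪f i, g i⟫_ℝ * ⟪f i, b i⟫_ℝ
      + ‖f i‖ ^ 2 * (⟪g i, b i⟫_ℝ + -k * ⟪f i, bp i⟫_ℝ * ⟪f i, bp i⟫_ℝ))
      ≤ 3 * N * (p * (C * p + η)) - k * ε ^ 2 := by
    have h1 : ∀ i, 2 * ⟪f i, g i⟫_ℝ * ⟪f i, b i⟫_ℝ
        + ‖f i‖ ^ 2 * (⟪g i, b i⟫_ℝ + -k * ⟪f i, bp i⟫_ℝ * ⟪f i, bp i⟫_ℝ)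
        ≤ 3 * (p * (C * p + η)) - k * (‖f i‖ ^ 2 * (⟪f i, bp i⟫_ℝ * ⟪f i, bp i⟫_ℝ)) :=
      fun i => by
      have h2 : ⟪f i, g i⟫_ℝ * ⟪f i, b i⟫_ℝ ≤ ‖f i‖ ^ 2 * ‖g i‖ := by
        calc ⟪f i, g i⟫_ℝ * ⟪f i, b i⟫_ℝ ≤ |⟪f i, g i⟫_ℝ| * |⟪f i, b i⟫_ℝ| := by
              rw [← abs_mul]; exact le_abs_self _
          _ ≤ (‖f i‖ * ‖g i‖) * ‖f i‖ :=
              mul_le_mul (abs_real_inner_le_norm _ _) (hfb i) (abs_nonneg _) (by positivity)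
          _ = ‖f i‖ ^ 2 * ‖g i‖ := by ring
      have h3 : ‖f i‖ ^ 2 * ⟪g i, b i⟫_ℝ ≤ ‖f i‖ ^ 2 * ‖g i‖ := by
        gcongr
        simpa [hb i] using real_inner_le_norm (g i) (b i)
      have h4 : ‖f i‖ ^ 2 * ‖g i‖ ≤ p * (C * p + η) :=
        mul_le_mul (hfp i) (hgn i) (norm_nonneg _) hp0
      linarith
    refine (Finset.sum_le_sum fun i _ => h1 i).trans ?_
    rw [Finset.sum_sub_distrib, hε2, Finset.mul_sum]
    simp only [Finset.sum_const, Finset.card_univ, nsmul_eq_mul, ← hN]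
    linarith
  rw [Finset.sum_add_distrib, ← Finset.mul_sum, ← hp2, ← hη2]
  refine le_trans ?_ (absorb_cross_terms (C := C) (e := ε) hc hμ0 hμ1 hμc hN0 hp0 hη0 hk)
  gcongr

theorem hasDerivWithinAt_norm_pow_three {f : ℝ → E} {f' : E} {s : Set ℝ} {t : ℝ}
    (hf : HasDerivWithinAt f f' s t) :
    HasDerivWithinAt (fun r => ‖f r‖ ^ 3) (3 * (‖f t‖ * ⟪f t, f'⟫_ℝ)) s t := by
  have h := (hasFDerivAt_norm_rpow (f t) (p := 3) (by norm_num)).comp_hasDerivWithinAt t hf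
  have h3 : ∀ r, ‖f r‖ ^ (3 : ℝ) = ‖f r‖ ^ 3 := fun r => by exact_mod_cast Real.rpow_natCast _ 3
  refine (h.congr_deriv ?_).congr (fun r _ => (h3 r).symm) (h3 t).symm
  have h1 : (3 : ℝ) - 2 = 1 := by norm_num
  rw [h1, Real.rpow_one, _root_.smul_apply, innerSL_apply_apply, smul_eq_mul, mul_assoc]

/-- Time derivative of one summand of the Lyapunov function. -/
theorem hasDerivWithinAt_lyapunov_summand {f b : ℝ → E} {f' bp : E} {γ μ ω : ℝ} {s : Set ℝ} {t : ℝ}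
    (hf : HasDerivWithinAt f f' s t) (hb : HasDerivWithinAt b (ω • bp) s t) :
    HasDerivWithinAt (fun r => γ / 3 * ‖f r‖ ^ 3 + μ * (‖f r‖ ^ 2 * ⟪f r, b r⟫_ℝ))
      (γ * (‖f t‖ * ⟪f t, f'⟫_ℝ) + μ * (2 * ⟪f t, f'⟫_ℝ * ⟪f t, b t⟫_ℝ
        + ‖f t‖ ^ 2 * (⟪f', b t⟫_ℝ + ω * ⟪f t, bp⟫_ℝ))) s t := by
  have h1 := (hasDerivWithinAt_norm_pow_three hf).const_mul (γ / 3)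
  have h2 := (hf.norm_sq.mul (hf.inner ℝ hb)).const_mul μ
  refine (h1.add h2).congr_deriv ?_
  rw [real_inner_smul_right]
  ring

theorem lyapunov_summand_bounds {f b : E} {γ μ : ℝ} (hμ : 0 < μ) (hμγ : μ ≤ γ / 6) (hb : ‖b‖ = 1) :
    μ * ‖f‖ ^ 3 ≤ γ / 3 * ‖f‖ ^ 3 + μ * (‖f‖ ^ 2 * ⟪f, b⟫_ℝ) ∧
      γ / 3 * ‖f‖ ^ 3 + μ * (‖f‖ ^ 2 * ⟪f, b⟫_ℝ) ≤ γ * ‖f‖ ^ 3 := by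
  have h1 : |⟪f, b⟫_ℝ| ≤ ‖f‖ := by simpa [hb] using abs_real_inner_le_norm f b
  obtain ⟨h2, h3⟩ := abs_le.1 h1
  have h4 : μ * (‖f‖ ^ 2 * ⟪f, b⟫_ℝ) ≤ μ * (‖f‖ ^ 2 * ‖f‖) := by gcongr
  have h5 : μ * (‖f‖ ^ 2 * -‖f‖) ≤ μ * (‖f‖ ^ 2 * ⟪f, b⟫_ℝ) := by gcongr
  have h6 : 0 ≤ ‖f‖ ^ 3 := by positivity
  constructor <;> nlinarith

end Dissipation

section Kinematics

theorem rotM_inv_mulVec (θ : ℝ) (v : Fin 2 → ℝ) :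
    (rotM θ)⁻¹ *ᵥ v
      = ![Real.cos θ * v 0 + Real.sin θ * v 1, -Real.sin θ * v 0 + Real.cos θ * v 1] := by
  have hdet : (rotM θ).det = 1 := by
    rw [rotM, Matrix.det_fin_two_of]
    nlinarith [Real.sin_sq_add_cos_sq θ]
  rw [Matrix.inv_def, hdet, rotM, Matrix.adjugate_fin_two_of]
  ext k
  fin_cases k <;> simp [Matrix.mulVec, dotProduct, Fin.sum_univ_two]

theorem rotM_mulVec_e1 (θ : ℝ) : rotM θ *ᵥ ![1, 0] = ![Real.cos θ, Real.sin θ] := by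
  ext k
  fin_cases k <;> simp [rotM, Matrix.mulVec, dotProduct, Fin.sum_univ_two]

theorem enorm2_eq_norm (v : Fin 2 → ℝ) : enorm2 v = ‖WithLp.toLp 2 v‖ := by
  simp [enorm2, EuclideanSpace.norm_eq, Fin.sum_univ_two]

theorem enorm2_nonneg (v : Fin 2 → ℝ) : 0 ≤ enorm2 v := Real.sqrt_nonneg _

variable {n : ℕ} (Adj : Fin n → Fin n → Bool) (a : Fin n → Fin n → ℝ)

theorem abs_rotM_inv_mulVec_le (θ : ℝ) (v : Fin 2 → ℝ) (k : Fin 2) :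
    |((rotM θ)⁻¹ *ᵥ v) k| ≤ enorm2 v := by
  rw [rotM_inv_mulVec, enorm2]
  apply Real.abs_le_sqrt
  have h := Real.sin_sq_add_cos_sq θ
  have key : (Real.cos θ * v 0 + Real.sin θ * v 1) ^ 2
      + (-Real.sin θ * v 0 + Real.cos θ * v 1) ^ 2 = v 0 ^ 2 + v 1 ^ 2 := by
    linear_combination (v 0 ^ 2 + v 1 ^ 2) * h
  fin_cases k
  · simp only [Fin.zero_eta, Matrix.cons_val_zero]
    nlinarith [sq_nonneg (-Real.sin θ * v 0 + Real.cos θ * v 1)]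
  · simp only [Fin.mk_one, Matrix.cons_val_one, Matrix.cons_val_fin_one]
    nlinarith [sq_nonneg (Real.cos θ * v 0 + Real.sin θ * v 1)]

/-- The closed-loop vector field on the state space of positions and headings. -/
noncomputable def closedLoopField (k1 : ℝ) (p : (Fin n → Fin 2 → ℝ) × (Fin n → ℝ)) :
    (Fin n → Fin 2 → ℝ) × (Fin n → ℝ) :=
  (fun i => uFB Adj a p.1 (p.2 i) i • (rotM (p.2 i) *ᵥ ![1, 0]),
    fun i => omegaFB k1 Adj a p.1 (p.2 i) i)

theorem contDiff_fcons (i : Fin n) :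
    ContDiff ℝ 1 fun x : Fin n → Fin 2 → ℝ => fcons Adj a x i := by
  unfold fcons
  refine ContDiff.sum fun j _ => ?_
  split_ifs
  · fun_prop
  · exact contDiff_const

theorem locallyLipschitz_closedLoopField (k1 : ℝ) :
    LocallyLipschitz (closedLoopField Adj a k1) := by
  set G : (Fin n → ℝ) × ((Fin n → Fin 2 → ℝ) × (Fin n → ℝ)) →
      (Fin n → Fin 2 → ℝ) × (Fin n → ℝ) := fun q =>
    (fun i => (q.1 i * (Real.cos (q.2.2 i) * fcons Adj a q.2.1 i 0
        + Real.sin (q.2.2 i) * fcons Adj a q.2.1 i 1)) •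
          ![Real.cos (q.2.2 i), Real.sin (q.2.2 i)],
      fun i => -k1 * (-Real.sin (q.2.2 i) * fcons Adj a q.2.1 i 0
        + Real.cos (q.2.2 i) * fcons Adj a q.2.1 i 1)) with hG
  have hf : ∀ i k, ContDiff ℝ 1 fun q : (Fin n → ℝ) × ((Fin n → Fin 2 → ℝ) × (Fin n → ℝ)) =>
      fcons Adj a q.2.1 i k := fun i k =>
    (contDiff_pi.1 (contDiff_fcons Adj a i) k).comp (contDiff_fst.comp contDiff_snd)
  have hGc : ContDiff ℝ 1 G := by
    refine ContDiff.prodMk (contDiff_pi.2 fun i => ?_) (contDiff_pi.2 fun i => ?_)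
    · have h0 := hf i 0
      have h1 := hf i 1
      have h2 : ContDiff ℝ 1 fun q : (Fin n → ℝ) × ((Fin n → Fin 2 → ℝ) × (Fin n → ℝ)) =>
          q.1 i * (Real.cos (q.2.2 i) * fcons Adj a q.2.1 i 0
            + Real.sin (q.2.2 i) * fcons Adj a q.2.1 i 1) := by
        fun_prop
      refine h2.smul (contDiff_pi.2 fun k => ?_)
      fin_cases k
      · simp only [Fin.zero_eta, Matrix.cons_val_zero]; fun_prop
      · simp only [Fin.mk_one, Matrix.cons_val_one, Matrix.cons_val_fin_one]; fun_prop
    · have h0 := hf i 0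
      have h1 := hf i 1
      fun_prop
  have hn : LocallyLipschitz fun p : (Fin n → Fin 2 → ℝ) × (Fin n → ℝ) =>
      fun i => enorm2 (fcons Adj a p.1 i) := by
    have h1 : LipschitzWith 1 fun v : Fin n → EuclideanSpace ℝ (Fin 2) => fun i => ‖v i‖ :=
      LipschitzWith.of_dist_le_mul fun u v => by
        rw [NNReal.coe_one, one_mul]
        refine (dist_pi_le_iff dist_nonneg).2 fun i => ?_
        exact (dist_norm_norm_le (u i) (v i)).trans
          ((dist_eq_norm (u i) (v i)).symm.le.trans (dist_le_pi_dist u v i))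
    have h2 : ContDiff ℝ 1 fun p : (Fin n → Fin 2 → ℝ) × (Fin n → ℝ) =>
        fun i => WithLp.toLp 2 (fcons Adj a p.1 i) :=
      contDiff_pi.2 fun i => PiLp.contDiff_toLp.comp ((contDiff_fcons Adj a i).comp contDiff_fst)
    simp_rw [enorm2_eq_norm]
    exact h1.locallyLipschitz.comp h2.locallyLipschitz
  have hcomp : closedLoopField Adj a k1
      = G ∘ fun p => (fun i => enorm2 (fcons Adj a p.1 i), p) := by
    funext p
    simp only [hG, closedLoopField, uFB, omegaFB, rotM_inv_mulVec, rotM_mulVec_e1]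
    rfl
  rw [hcomp]
  exact hGc.locallyLipschitz.comp (hn.prodMk LocallyLipschitz.id)

theorem norm_closedLoopField_le {k1 M : ℝ} {p : (Fin n → Fin 2 → ℝ) × (Fin n → ℝ)} (hM0 : 0 ≤ M)
    (hM : ∀ i, enorm2 (fcons Adj a p.1 i) ≤ M) :
    ‖closedLoopField Adj a k1 p‖ ≤ max (M * M) (|k1| * M) := by
  refine max_le_max ?_ ?_
  · refine (pi_norm_le_iff_of_nonneg (by positivity)).2 fun i => ?_
    simp only [closedLoopField, rotM_mulVec_e1, norm_smul]
    have h1 : ‖(![Real.cos (p.2 i), Real.sin (p.2 i)] : Fin 2 → ℝ)‖ ≤ 1 :=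
      (pi_norm_le_iff_of_nonneg zero_le_one).2 fun k => by
        fin_cases k
        · simpa using Real.abs_cos_le_one (p.2 i)
        · simpa using Real.abs_sin_le_one (p.2 i)
    have h2 : ‖uFB Adj a p.1 (p.2 i) i‖ ≤ M * M := by
      rw [uFB, norm_mul, Real.norm_eq_abs, Real.norm_eq_abs, abs_of_nonneg (enorm2_nonneg _)]
      exact mul_le_mul (hM i) ((abs_rotM_inv_mulVec_le _ _ _).trans (hM i)) (abs_nonneg _) hM0
    calc _ ≤ M * M * 1 := mul_le_mul h2 h1 (norm_nonneg _) (by positivity)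
      _ = M * M := mul_one _
  · refine (pi_norm_le_iff_of_nonneg (by positivity)).2 fun i => ?_
    simp only [closedLoopField, omegaFB, norm_mul, norm_neg, Real.norm_eq_abs]
    gcongr
    exact (abs_rotM_inv_mulVec_le _ _ _).trans (hM i)

/-- A solution of the full system along which all `f i` are bounded can be continued beyond any
finite time. -/
theorem not_isMaxSolSub_of_bounded {k1 : ℝ} {x : ℝ → Fin n → Fin 2 → ℝ} {θ : ℝ → Fin n → ℝ}
    {T : ℝ≥0∞} (hT : T ≠ ⊤) {M : ℝ}
    (hM : ∀ t, 0 ≤ t → ENNReal.ofReal t < T → ∀ i, enorm2 (fcons Adj a (x t) i) ≤ M) :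
    ¬IsMaxSolSub Adj a k1 Finset.univ x θ T := by
  rintro ⟨hsol, hmax⟩
  rcases eq_or_ne T 0 with rfl | hT0
  · have hf : ∀ i, fcons Adj a 0 i = 0 := fun i => by simp [fcons]
    refine hmax (fun _ => 0) (fun _ => 0) ⊤ (by simp) (fun t _ _ i _ => ⟨?_, ?_⟩) (by simp)
    · simpa [uFB, hf] using hasDerivWithinAt_const t (Set.Ici 0) (0 : Fin 2 → ℝ)
    · simpa [omegaFB, hf] using hasDerivWithinAt_const t (Set.Ici 0) (0 : ℝ)
  · have hτ : 0 < T.toReal := ENNReal.toReal_pos hT0 hT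
    obtain ⟨z', τ', hτ', hz', heq⟩ := exists_extension_of_bounded
      (locallyLipschitz_closedLoopField Adj a k1) (z := fun t => (x t, θ t)) hτ
      (fun t ht htT => by
        have h := hsol t ht ((ENNReal.ofReal_lt_iff_lt_toReal ht hT).2 htT)
        exact (hasDerivWithinAt_pi.2 fun i => (h i (Finset.mem_univ i)).1).prodMk
          (hasDerivWithinAt_pi.2 fun i => (h i (Finset.mem_univ i)).2))
      (fun t ht htT => norm_closedLoopField_le Adj a (le_max_right M 0) fun i =>
        (hM t ht ((ENNReal.ofReal_lt_iff_lt_toReal ht hT).2 htT) i).trans (le_max_left M 0))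
    refine hmax (fun t => (z' t).1) (fun t => (z' t).2) (ENNReal.ofReal τ')
      ((ENNReal.lt_ofReal_iff_toReal_lt hT).2 hτ') (fun t ht htT i _ => ?_) fun t ht htT i _ => ?_
    · have h := hz' t ht ((ENNReal.ofReal_lt_ofReal_iff_of_nonneg ht).1 htT)
      exact ⟨hasDerivWithinAt_pi.1 h.fst i, hasDerivWithinAt_pi.1 h.snd i⟩
    · rw [heq t ((ENNReal.ofReal_lt_iff_lt_toReal ht hT).1 htT)]
      exact ⟨rfl, rfl⟩

end Kinematics

section LeaderFollower

open scoped InnerProductSpace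

variable {ι E : Type*} [Fintype ι] [NormedAddCommGroup E] [InnerProductSpace ℝ E]

/-- The consensus field `∑ j, w i j • (X j - X i)`. -/
def consensus (w : ι → ι → ℝ) (X : ι → E) (i : ι) : E := ∑ j, w i j • (X j - X i)

/-- The vertices of a weighted digraph split into an isolated set `A` and a strongly connected
set `B`, with an edge from `B` to `A` unless `A` is empty. -/
structure IsolatedSplit [DecidableEq ι] (w : ι → ι → ℝ) (A B : Finset ι) : Prop where
  nonneg : ∀ i j, 0 ≤ w i j
  disjoint : Disjoint A B
  cover : A ∪ B = Finset.univ
  nonempty : B.Nonempty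
  isolated : ∀ i ∈ A, ∀ j ∉ A, w i j = 0
  strong : ∀ i j : B, Relation.ReflTransGen (fun p q : B => 0 < w p q) i j
  reach : A.Nonempty → ∃ i : B, ∑ j ∈ A, w i j ≠ 0

theorem norm_sum_smul_le {w : ι → ι → ℝ} (hw : ∀ i j, 0 ≤ w i j) (i : ι) {s : Finset ι}
    {v : ι → E} {r : ℝ} (hr : 0 ≤ r) (hv : ∀ j ∈ s, ‖v j‖ ≤ r) :
    ‖∑ j ∈ s, w i j • v j‖ ≤ (∑ i, ∑ j, w i j) * r := by
  calc ‖∑ j ∈ s, w i j • v j‖ ≤ ∑ j ∈ s, w i j * r :=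
        norm_sum_le_of_le _ fun j hj => by
          rw [norm_smul, Real.norm_eq_abs, abs_of_nonneg (hw i j)]
          exact mul_le_mul_of_nonneg_left (hv j hj) (hw i j)
    _ = (∑ j ∈ s, w i j) * r := by rw [Finset.sum_mul]
    _ ≤ (∑ i, ∑ j, w i j) * r := by
        refine mul_le_mul_of_nonneg_right ?_ hr
        exact (Finset.sum_le_univ_sum_of_nonneg (hw i)).trans
          (Finset.single_le_sum (f := fun i => ∑ j, w i j)
            (fun i _ => Finset.sum_nonneg fun j _ => hw i j) (Finset.mem_univ i))

theorem hasDerivWithinAt_consensus {w : ι → ι → ℝ} {X : ℝ → ι → E} {v : ι → E} {s : Set ℝ} {t : ℝ}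
    (hX : ∀ i, HasDerivWithinAt (fun r => X r i) (v i) s t) (i : ι) :
    HasDerivWithinAt (fun r => consensus w (X r) i) (consensus w v i) s t :=
  HasDerivWithinAt.fun_sum fun j _ => ((hX j).sub (hX i)).const_smul (w i j)

variable [DecidableEq ι] {w : ι → ι → ℝ} {A B : Finset ι}

namespace IsolatedSplit

theorem sum_eq (hS : IsolatedSplit w A B) {M : Type*} [AddCommMonoid M] (F : ι → M) :
    ∑ j, F j = ∑ j : B, F j + ∑ j ∈ A, F j := by
  rw [← hS.cover, Finset.sum_union hS.disjoint, add_comm, Finset.sum_coe_sort B F]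

/-- The field of a vertex of `B`, relative to the origin `p`. -/
theorem consensus_eq (hS : IsolatedSplit w A B) (X : ι → E) (i : B) (p : E) :
    consensus w X i = ∑ j : B, w i j • ((X j - p) - (X i - p)) - (∑ j ∈ A, w i j) • (X i - p)
      + ∑ j ∈ A, w i j • (X j - p) := by
  rw [consensus, hS.sum_eq, sub_add_eq_add_sub, add_sub_assoc, Finset.sum_smul,
    ← Finset.sum_sub_distrib]
  simp only [← smul_sub, sub_sub_sub_cancel_right]

theorem eq_of_consensus_eq_zero (hS : IsolatedSplit w A B) {X : ι → E}
    (hB : ∀ i ∈ B, consensus w X i = 0) (hA : ∀ i ∈ A, ∀ j ∈ A, X i = X j) (i j : ι) :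
    X i = X j := by
  have : Nonempty B := hS.nonempty.to_subtype
  have hmem : ∀ k, k ∈ A ∨ k ∈ B := fun k => by
    rw [← Finset.mem_union, hS.cover]; exact Finset.mem_univ k
  obtain ⟨γ, hγ, hnull⟩ := exists_pos_left_null (m := fun i j : B => w i j)
    (fun i j => hS.nonneg i j) hS.strong
  have key : ∀ p : E, (∀ j ∈ A, X j = p) →
      (∀ i j : B, X i - p = X j - p) ∧ ∀ i : B, ∑ j ∈ A, w i j ≠ 0 → X i - p = 0 := fun p hp => by
    refine eq_of_groundedForm_eq_zero (m := fun i j : B => w i j) (d := fun i => ∑ j ∈ A, w i j)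
      (γ := γ) (fun i j => hS.nonneg i j) hS.strong
      (fun i => Finset.sum_nonneg fun j _ => hS.nonneg i j) hγ (w := fun i : B => X i - p) ?_
    rw [← neg_eq_zero, ← sum_inner_laplacian_eq_neg_groundedForm hnull]
    refine Finset.sum_eq_zero fun i _ => ?_
    have h1 := hS.consensus_eq X i p
    have h2 : ∑ j ∈ A, w i j • (X j - p) = 0 := Finset.sum_eq_zero fun j hj => by
      rw [hp j hj, sub_self, smul_zero]
    rw [hB i i.2, h2, add_zero] at h1
    rw [← h1, inner_zero_right, mul_zero]
  rcases A.eq_empty_or_nonempty with h0 | ⟨a₀, ha₀⟩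
  · have h := (key 0 (by simp [h0])).1
    have hB' : ∀ k, k ∈ B := fun k => (hmem k).resolve_left (by simp [h0])
    simpa using h ⟨i, hB' i⟩ ⟨j, hB' j⟩
  · obtain ⟨hc, hz⟩ := key (X a₀) fun j hj => hA j hj a₀ ha₀
    obtain ⟨i₀, hi₀⟩ := hS.reach ⟨a₀, ha₀⟩
    have hall : ∀ k, X k = X a₀ := fun k => by
      rcases hmem k with hk | hk
      · exact hA k hk a₀ ha₀
      · rw [← sub_eq_zero, hc ⟨k, hk⟩ i₀, hz i₀ hi₀]
    rw [hall i, hall j]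

/-- The diameter is controlled by the field on `B` and the diameter of `A`. -/
theorem exists_diam_bound [FiniteDimensional ℝ E] (hS : IsolatedSplit w A B) :
    ∃ C : ℝ, 0 ≤ C ∧ ∀ (X : ι → E) (r : ℝ), 0 ≤ r → (∀ i ∈ B, ‖consensus w X i‖ ≤ r) →
      (∀ i ∈ A, ∀ j ∈ A, ‖X i - X j‖ ≤ r) → ∀ i j, ‖X i - X j‖ ≤ C * r := by
  let P : (ι → E) →ₗ[ℝ] (B → E) × (A → A → E) :=
    { toFun := fun X => (fun i => consensus w X i, fun i j => X i - X j)
      map_add' := fun X Y => by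
        ext <;> simp [consensus, add_sub_add_comm, smul_add, Finset.sum_add_distrib]
      map_smul' := fun c X => by
        ext <;> simp [consensus, ← smul_sub, Finset.smul_sum, smul_comm c] }
  let Q : (ι → E) →ₗ[ℝ] (ι → ι → E) :=
    { toFun := fun X i j => X i - X j
      map_add' := fun X Y => by ext; simp [add_sub_add_comm]
      map_smul' := fun c X => by ext; simp [← smul_sub] }
  have hker : LinearMap.ker P ≤ LinearMap.ker Q := fun X hX => by
    have h0 : P X = 0 := hX
    have h1 := congrArg Prod.fst h0
    have h2 := congrArg Prod.snd h0
    refine LinearMap.mem_ker.2 (funext fun i => funext fun j => sub_eq_zero.2 ?_)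
    exact hS.eq_of_consensus_eq_zero (fun i hi => congrFun h1 ⟨i, hi⟩)
      (fun i hi j hj => sub_eq_zero.1 (congrFun (congrFun h2 ⟨i, hi⟩) ⟨j, hj⟩)) i j
  obtain ⟨R, hR⟩ := LinearMap.exists_extend
    (((LinearMap.ker P).liftQ Q hker).comp P.quotKerEquivRange.symm.toLinearMap)
  have hRP : ∀ X, R (P X) = Q X := fun X => by
    have h := LinearMap.congr_fun hR ⟨P X, LinearMap.mem_range_self P X⟩
    have h2 : P.quotKerEquivRange.symm ⟨P X, LinearMap.mem_range_self P X⟩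
        = Submodule.Quotient.mk X := by
      rw [LinearEquiv.symm_apply_eq]
      rfl
    simpa [h2] using h
  refine ⟨‖LinearMap.toContinuousLinearMap R‖, ContinuousLinearMap.opNorm_nonneg _,
    fun X r hr hB hA i j => ?_⟩
  have hP : ‖P X‖ ≤ r := by
    refine norm_prod_le_iff.2 ⟨(pi_norm_le_iff_of_nonneg hr).2 fun i => hB i i.2,
      (pi_norm_le_iff_of_nonneg hr).2 fun i => (pi_norm_le_iff_of_nonneg hr).2 fun j =>
        hA i i.2 j j.2⟩
  calc ‖X i - X j‖ = ‖Q X i j‖ := rfl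
    _ ≤ ‖Q X‖ := (norm_le_pi_norm (Q X i) j).trans (norm_le_pi_norm (Q X) i)
    _ = ‖LinearMap.toContinuousLinearMap R (P X)‖ := by rw [← hRP]; rfl
    _ ≤ _ := (ContinuousLinearMap.le_opNorm _ _).trans
        (mul_le_mul_of_nonneg_left hP (ContinuousLinearMap.opNorm_nonneg _))

theorem norm_consensus_le (hS : IsolatedSplit w A B) {X : ι → E} {r : ℝ} (hr : 0 ≤ r)
    (hX : ∀ i j, ‖X i - X j‖ ≤ r) (i : ι) : ‖consensus w X i‖ ≤ (∑ i, ∑ j, w i j) * r :=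
  norm_sum_smul_le hS.nonneg i hr fun j _ => hX j i

theorem norm_consensus_le_of_mem (hS : IsolatedSplit w A B) {X : ι → E} {r : ℝ} (hr : 0 ≤ r)
    (hX : ∀ i ∈ A, ∀ j ∈ A, ‖X i - X j‖ ≤ r) {i : ι} (hi : i ∈ A) :
    ‖consensus w X i‖ ≤ (∑ i, ∑ j, w i j) * r := by
  have h : consensus w X i = ∑ j ∈ A, w i j • (X j - X i) :=
    (Finset.sum_subset (Finset.subset_univ A) fun j _ hj => by
      rw [hS.isolated i hi j hj, zero_smul]).symm
  rw [h]
  exact norm_sum_smul_le hS.nonneg i hr fun j hj => hX j hj i hi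

/-- If no vertex of `B` sees `A`, the left null vector annihilates the fields on `B`. -/
theorem sum_smul_consensus_eq_zero (hS : IsolatedSplit w A B) {γ : B → ℝ}
    (hnull : ∀ j : B, ∑ i : B, γ i * w i j = γ j * ∑ k : B, w j k)
    (hd : ∀ i : B, ∑ j ∈ A, w i j = 0) (X : ι → E) : ∑ i : B, γ i • consensus w X i = 0 := by
  have h1 : ∀ i : B, consensus w X i = ∑ j : B, w i j • (X j - X i) := fun i => by
    rw [consensus, hS.sum_eq, add_eq_left]
    refine Finset.sum_eq_zero fun j hj => ?_
    rw [(Finset.sum_eq_zero_iff_of_nonneg fun j _ => hS.nonneg i j).1 (hd i) j hj, zero_smul]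
  simp only [h1, Finset.smul_sum, smul_smul, smul_sub, Finset.sum_sub_distrib, ← Finset.sum_smul]
  rw [Finset.sum_comm, sub_eq_zero]
  refine Finset.sum_congr rfl fun j _ => ?_
  rw [← Finset.sum_smul, hnull]

/-- A Lyapunov-type function for the followers, driven by the diameter of the leaders: it decays
at a definite rate as long as it is large compared with the cube of that diameter. -/
theorem exists_lyapunov [FiniteDimensional ℝ E] (hS : IsolatedSplit w A B) :
    ∃ (k0 K R : ℝ) (V : (ι → E) → (ι → E) → ℝ), 0 < K ∧ 0 < R ∧
      (∀ (X b : ι → E) (m : ℝ), 0 ≤ m → (∀ i, ‖b i‖ = 1) → V X b ≤ K * m ^ 3 →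
        (∀ i ∈ A, ∀ j ∈ A, ‖X i - X j‖ ≤ m) → ∀ i j, ‖X i - X j‖ ≤ R * m) ∧
      (∀ (X b : ι → E) (m : ℝ), 0 ≤ m → (∀ i, ‖b i‖ = 1) → (∀ i j, ‖X i - X j‖ ≤ m) →
        V X b ≤ R * m ^ 3) ∧
      ∀ (k : ℝ) (X b : ℝ → ι → E) (bp : ι → E) (s : Set ℝ) (t : ℝ), k0 ≤ k →
        (∀ i, ‖b t i‖ = 1) → (∀ i, ‖bp i‖ = 1) →
        (∀ i (u : E), u = ⟪u, b t i⟫_ℝ • b t i + ⟪u, bp i⟫_ℝ • bp i) →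
        (∀ i, HasDerivWithinAt (fun r => X r i)
          ((‖consensus w (X t) i‖ * ⟪consensus w (X t) i, b t i⟫_ℝ) • b t i) s t) →
        (∀ i, HasDerivWithinAt (fun r => b r i)
          ((-k * ⟪consensus w (X t) i, bp i⟫_ℝ) • bp i) s t) →
        ∃ V' : ℝ, HasDerivWithinAt (fun r => V (X r) (b r)) V' s t ∧
          ∀ m, 0 < m → (∀ i ∈ A, ∀ j ∈ A, ‖X t i - X t j‖ ≤ m) → K * m ^ 3 ≤ V (X t) (b t) →
            V' ≤ -m ^ 4 := by
  have : Nonempty B := hS.nonempty.to_subtype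
  obtain ⟨γ, hγ, hnull⟩ := exists_pos_left_null (m := fun i j : B => w i j)
    (fun i j => hS.nonneg i j) hS.strong
  obtain ⟨μ, k0, c, C, hμ, hc, hC, hμγ, hdiss⟩ := exists_dissipation (E := E)
    (m := fun i j : B => w i j) (d := fun i : B => ∑ j ∈ A, w i j) (fun i j => hS.nonneg i j)
    hS.strong (fun i => Finset.sum_nonneg fun j _ => hS.nonneg i j) hγ hnull
  obtain ⟨D, hD, hdiam⟩ := hS.exists_diam_bound (E := E)
  set W := ∑ i, ∑ j, w i j with hW
  have hW0 : 0 ≤ W := Finset.sum_nonneg fun i _ => Finset.sum_nonneg fun j _ => hS.nonneg i j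
  set G := ∑ i, γ i with hG
  have hG0 : 0 < G := Finset.sum_pos (fun i _ => hγ i) Finset.univ_nonempty
  set N : ℝ := (Fintype.card B : ℝ) with hN
  have hN0 : 0 ≤ N := Nat.cast_nonneg _
  set ρ := 1 + (1 + C * (N * W ^ 6)) / c with hρ
  have hρ1 : 1 ≤ ρ := le_add_of_nonneg_right (by positivity)
  have hρ0 : 0 < ρ := one_pos.trans_le hρ1
  have hcρ : 1 + C * (N * W ^ 6) ≤ c * ρ ^ 4 := by
    have h1 : c * ρ = c + (1 + C * (N * W ^ 6)) := by rw [hρ]; field_simp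
    have h2 : ρ ≤ ρ ^ 4 := le_self_pow₀ hρ1 (by norm_num)
    nlinarith
  set K := G * ρ ^ 3 with hK
  have hK0 : 0 < K := by positivity
  set σ := 1 + K / μ with hσ
  have hσ1 : 1 ≤ σ := le_add_of_nonneg_right (by positivity)
  have hKσ : K ≤ μ * σ ^ 3 := by
    have h1 : μ * σ = μ + K := by rw [hσ]; field_simp
    have h2 : σ ≤ σ ^ 3 := le_self_pow₀ hσ1 (by norm_num)
    nlinarith
  set V : (ι → E) → (ι → E) → ℝ := fun X b => ∑ i : B, (γ i / 3 * ‖consensus w X i‖ ^ 3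
    + μ * (‖consensus w X i‖ ^ 2 * ⟪consensus w X i, b i⟫_ℝ)) with hV
  have hVle : ∀ (X b : ι → E), (∀ i, ‖b i‖ = 1) →
      V X b ≤ ∑ i : B, γ i * ‖consensus w X i‖ ^ 3 := fun X b hb =>
    Finset.sum_le_sum fun i _ => (lyapunov_summand_bounds hμ (hμγ i) (hb i)).2
  refine ⟨k0, K, D * σ + G * W ^ 3 + 1, V, hK0, by positivity, ?_, ?_, ?_⟩
  · intro X b m hm hb hVm hA i j
    have hσm : ∀ i ∈ B, ‖consensus w X i‖ ≤ σ * m := fun i hi => by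
      have h1 : μ * ‖consensus w X i‖ ^ 3 ≤ V X b :=
        (lyapunov_summand_bounds hμ (hμγ ⟨i, hi⟩) (hb i)).1.trans
          (Finset.single_le_sum (f := fun i : B => γ i / 3 * ‖consensus w X i‖ ^ 3
            + μ * (‖consensus w X i‖ ^ 2 * ⟪consensus w X i, b i⟫_ℝ))
            (fun k _ => (by positivity : 0 ≤ μ * ‖consensus w X k‖ ^ 3).trans
              (lyapunov_summand_bounds hμ (hμγ k) (hb k)).1) (Finset.mem_univ (⟨i, hi⟩ : B)))
      have h2 : μ * ‖consensus w X i‖ ^ 3 ≤ μ * (σ * m) ^ 3 := by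
        rw [mul_pow, ← mul_assoc]
        exact h1.trans (hVm.trans (mul_le_mul_of_nonneg_right hKσ (by positivity)))
      exact (pow_le_pow_iff_left₀ (norm_nonneg _) (by positivity) three_ne_zero).1
        (le_of_mul_le_mul_left h2 hμ)
    have h1 : m ≤ σ * m := le_mul_of_one_le_left hm hσ1
    have h2 : 0 ≤ (G * W ^ 3 + 1) * m := by positivity
    have h3 := hdiam X (σ * m) (hm.trans h1) hσm (fun i hi j hj => (hA i hi j hj).trans h1) i j
    linarith
  · intro X b m hm hb hX
    have h1 : V X b ≤ G * (W * m) ^ 3 := by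
      refine (hVle X b hb).trans ?_
      rw [hG, Finset.sum_mul]
      refine Finset.sum_le_sum fun i _ => mul_le_mul_of_nonneg_left ?_ (hγ i).le
      exact pow_le_pow_left₀ (norm_nonneg _) (hS.norm_consensus_le hm hX i) 3
    have h2 : 0 ≤ (D * σ + 1) * m ^ 3 := by positivity
    linarith
  · intro k X b bp s t hk hb hbp hdecomp hX hbd
    set f : ι → E := consensus w (X t) with hf
    set v : ι → E := fun i => (‖f i‖ * ⟪f i, b t i⟫_ℝ) • b t i with hv
    refine ⟨_, HasDerivWithinAt.fun_sum fun i _ =>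
      hasDerivWithinAt_lyapunov_summand (hasDerivWithinAt_consensus hX i) (hbd i), ?_⟩
    intro m hm hA hVm
    have hd := hdiss k (fun i => f i) (fun i => b t i) (fun i => bp i)
      (fun i => consensus w v i) (fun i => ∑ j ∈ A, w i j • v j) hk
      (fun h => hS.sum_smul_consensus_eq_zero hnull h (X t)) (fun i => hb i) (fun i => hbp i)
      (fun i => hdecomp i _) (fun i => by simpa using hS.consensus_eq v i 0)
    refine hd.trans ?_
    have hvA : ∀ j ∈ A, ‖v j‖ ≤ (W * m) ^ 2 := fun j hj => by
      have h1 : ‖v j‖ ≤ ‖f j‖ ^ 2 := by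
        have h2 := abs_real_inner_le_norm (f j) (b t j)
        rw [hb j, mul_one] at h2
        rw [hv, norm_smul, hb j, mul_one, norm_mul, norm_norm, Real.norm_eq_abs, sq]
        exact mul_le_mul_of_nonneg_left h2 (norm_nonneg _)
      exact h1.trans (pow_le_pow_left₀ (norm_nonneg _)
        (hS.norm_consensus_le_of_mem hm.le hA hj) 2)
    have hh : ∑ i : B, ‖∑ j ∈ A, w i j • v j‖ ^ 2 ≤ N * W ^ 6 * m ^ 4 := by
      calc ∑ i : B, ‖∑ j ∈ A, w i j • v j‖ ^ 2 ≤ ∑ _i : B, (W * (W * m) ^ 2) ^ 2 :=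
            Finset.sum_le_sum fun i _ => pow_le_pow_left₀ (norm_nonneg _)
              (norm_sum_smul_le hS.nonneg i (by positivity) hvA) 2
        _ = N * W ^ 6 * m ^ 4 := by
            rw [Finset.sum_const, Finset.card_univ, nsmul_eq_mul]; ring
    obtain ⟨i₀, -, hi₀⟩ : ∃ i ∈ (Finset.univ : Finset B),
        γ i * (ρ * m) ^ 3 ≤ γ i * ‖f i‖ ^ 3 := by
      refine Finset.exists_le_of_sum_le Finset.univ_nonempty ?_
      rw [← Finset.sum_mul, ← hG, mul_pow, ← mul_assoc]
      exact hVm.trans (hVle _ _ hb)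
    have hi₁ : ρ * m ≤ ‖f i₀‖ :=
      (pow_le_pow_iff_left₀ (by positivity) (norm_nonneg _) three_ne_zero).1
        (le_of_mul_le_mul_left hi₀ (hγ i₀))
    have hsum : (ρ * m) ^ 4 ≤ ∑ i : B, ‖f i‖ ^ 4 :=
      (pow_le_pow_left₀ (by positivity) hi₁ 4).trans
        (Finset.single_le_sum (f := fun i : B => ‖f i‖ ^ 4) (fun i _ => by positivity)
          (Finset.mem_univ i₀))
    have h1 := mul_le_mul_of_nonneg_left hsum hc.le
    have h2 := mul_le_mul_of_nonneg_left hh hC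
    have h3 := mul_le_mul_of_nonneg_right hcρ (by positivity : (0 : ℝ) ≤ m ^ 4)
    rw [mul_pow] at h1
    linarith

end IsolatedSplit

end LeaderFollower

section Rendezvous

open scoped InnerProductSpace
open Filter Set

/-- The unit vector of a heading angle. -/
noncomputable def heading (θ : ℝ) : EuclideanSpace ℝ (Fin 2) :=
  WithLp.toLp 2 ![Real.cos θ, Real.sin θ]

/-- The unit vector orthogonal to a heading. -/
noncomputable def headingNormal (θ : ℝ) : EuclideanSpace ℝ (Fin 2) :=
  WithLp.toLp 2 ![-Real.sin θ, Real.cos θ]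

theorem norm_heading (θ : ℝ) : ‖heading θ‖ = 1 := by
  simp [heading, EuclideanSpace.norm_eq, Fin.sum_univ_two]

theorem norm_headingNormal (θ : ℝ) : ‖headingNormal θ‖ = 1 := by
  simp [headingNormal, EuclideanSpace.norm_eq, Fin.sum_univ_two]

theorem inner_heading (v : Fin 2 → ℝ) (θ : ℝ) :
    ⟪WithLp.toLp 2 v, heading θ⟫_ℝ = ((rotM θ)⁻¹ *ᵥ v) 0 := by
  rw [rotM_inv_mulVec]
  simp [heading, PiLp.inner_apply, Fin.sum_univ_two]

theorem inner_headingNormal (v : Fin 2 → ℝ) (θ : ℝ) :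
    ⟪WithLp.toLp 2 v, headingNormal θ⟫_ℝ = ((rotM θ)⁻¹ *ᵥ v) 1 := by
  rw [rotM_inv_mulVec]
  simp [headingNormal, PiLp.inner_apply, Fin.sum_univ_two]

theorem eq_inner_heading_smul_add (u : EuclideanSpace ℝ (Fin 2)) (θ : ℝ) :
    u = ⟪u, heading θ⟫_ℝ • heading θ + ⟪u, headingNormal θ⟫_ℝ • headingNormal θ := by
  have h := Real.sin_sq_add_cos_sq θ
  ext k
  fin_cases k
  · simp [heading, headingNormal, PiLp.inner_apply, Fin.sum_univ_two]
    linear_combination (-u 0) * h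
  · simp [heading, headingNormal, PiLp.inner_apply, Fin.sum_univ_two]
    linear_combination (-u 1) * h

theorem hasDerivAt_heading (θ : ℝ) : HasDerivAt heading (headingNormal θ) θ := by
  have h : HasDerivAt (fun θ : ℝ => ![Real.cos θ, Real.sin θ]) ![-Real.sin θ, Real.cos θ] θ := by
    refine hasDerivAt_pi.2 fun k => ?_
    fin_cases k
    · simpa using Real.hasDerivAt_cos θ
    · simpa using Real.hasDerivAt_sin θ
  exact (PiLp.hasFDerivAt_toLp 2 _).comp_hasDerivAt θ h

variable {n : ℕ} {Adj : Fin n → Fin n → Bool} {a : Fin n → Fin n → ℝ}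

/-- Positions as points of the Euclidean plane. -/
def planePos (x : Fin n → Fin 2 → ℝ) (i : Fin n) : EuclideanSpace ℝ (Fin 2) := WithLp.toLp 2 (x i)

/-- The weight of an ordered pair of vertices, zero off the edge set. -/
noncomputable def edgeWeight (Adj : Fin n → Fin n → Bool) (a : Fin n → Fin n → ℝ)
    (i j : Fin n) : ℝ := if Adj i j = true then a i j else 0

theorem toLp_fcons (x : Fin n → Fin 2 → ℝ) (i : Fin n) :
    WithLp.toLp 2 (fcons Adj a x i) = consensus (edgeWeight Adj a) (planePos x) i := by
  have h : fcons Adj a x i = ∑ j, edgeWeight Adj a i j • (x j - x i) :=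
    Finset.sum_congr rfl fun j _ => by
      unfold edgeWeight
      split_ifs
      · rfl
      · rw [zero_smul]
  rw [h, consensus, WithLp.toLp_sum]
  rfl

theorem enorm2_sub (x : Fin n → Fin 2 → ℝ) (i j : Fin n) :
    enorm2 (x i - x j) = ‖planePos x i - planePos x j‖ := enorm2_eq_norm _

theorem norm_sub_le_DmaxSub {S : Finset (Fin n)} (x : Fin n → Fin 2 → ℝ) {i j : Fin n}
    (hi : i ∈ S) (hj : j ∈ S) : ‖planePos x i - planePos x j‖ ≤ DmaxSub S x := by
  rw [← enorm2_sub]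
  exact (le_ciSup (f := fun j : S => enorm2 (x i - x j)) (finite_range _).bddAbove ⟨j, hj⟩).trans
    (le_ciSup (f := fun i : S => ⨆ j : S, enorm2 (x i - x j)) (finite_range _).bddAbove ⟨i, hi⟩)

theorem DmaxSub_le {S : Finset (Fin n)} {x : Fin n → Fin 2 → ℝ} {r : ℝ} (hr : 0 ≤ r)
    (h : ∀ i ∈ S, ∀ j ∈ S, ‖planePos x i - planePos x j‖ ≤ r) : DmaxSub S x ≤ r :=
  Real.iSup_le (fun i => Real.iSup_le (fun j => by
    rw [enorm2_sub]; exact h i i.2 j j.2) hr) hr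

theorem DmaxSub_nonneg (S : Finset (Fin n)) (x : Fin n → Fin 2 → ℝ) : 0 ≤ DmaxSub S x :=
  Real.iSup_nonneg fun _ => Real.iSup_nonneg fun _ => enorm2_nonneg _

theorem DmaxSub_mono {S S' : Finset (Fin n)} (h : S ⊆ S') (x : Fin n → Fin 2 → ℝ) :
    DmaxSub S x ≤ DmaxSub S' x :=
  DmaxSub_le (DmaxSub_nonneg S' x) fun _ hi _ hj => norm_sub_le_DmaxSub x (h hi) (h hj)

theorem IsSolOnSub.mono {k : ℝ} {S S' : Finset (Fin n)} {x : ℝ → Fin n → Fin 2 → ℝ}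
    {θ : ℝ → Fin n → ℝ} {T : ℝ≥0∞} (h : IsSolOnSub Adj a k S' x θ T) (hS : S ⊆ S') :
    IsSolOnSub Adj a k S x θ T := fun t ht htT i hi => h t ht htT i (hS hi)

theorem IsSolOnSub.hasDerivWithinAt_planePos {k : ℝ} {S : Finset (Fin n)}
    {x : ℝ → Fin n → Fin 2 → ℝ} {θ : ℝ → Fin n → ℝ} {T : ℝ≥0∞}
    (h : IsSolOnSub Adj a k S x θ T) {t : ℝ} (ht : 0 ≤ t) (htT : ENNReal.ofReal t < T) {i : Fin n}
    (hi : i ∈ S) :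
    HasDerivWithinAt (fun r => planePos (x r) i)
      ((‖consensus (edgeWeight Adj a) (planePos (x t)) i‖ *
        ⟪consensus (edgeWeight Adj a) (planePos (x t)) i, heading (θ t i)⟫_ℝ) • heading (θ t i))
      (Ici 0) t := by
  have h1 := (PiLp.hasFDerivAt_toLp (𝕜 := ℝ) 2 (x t i)).comp_hasDerivWithinAt t (h t ht htT i hi).1
  rw [← toLp_fcons, inner_heading, ← enorm2_eq_norm]
  rw [rotM_mulVec_e1] at h1
  exact h1

theorem IsSolOnSub.hasDerivWithinAt_heading {k : ℝ} {S : Finset (Fin n)}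
    {x : ℝ → Fin n → Fin 2 → ℝ} {θ : ℝ → Fin n → ℝ} {T : ℝ≥0∞}
    (h : IsSolOnSub Adj a k S x θ T) {t : ℝ} (ht : 0 ≤ t) (htT : ENNReal.ofReal t < T) {i : Fin n}
    (hi : i ∈ S) :
    HasDerivWithinAt (fun r => heading (θ r i))
      ((-k * ⟪consensus (edgeWeight Adj a) (planePos (x t)) i, headingNormal (θ t i)⟫_ℝ) •
        headingNormal (θ t i)) (Ici 0) t := by
  rw [← toLp_fcons, inner_headingNormal]
  exact (hasDerivAt_heading (θ t i)).scomp_hasDerivWithinAt t (h t ht htT i hi).2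

theorem isolatedSplit_edgeWeight (ha : ∀ i j, Adj i j = true → 0 < a i j)
    (htree : ∃ r : Fin n, ∀ i, Relation.ReflTransGen (fun p q => Adj p q = true) i r)
    {A B : Finset (Fin n)} (hdisj : Disjoint A B) (hcover : A ∪ B = Finset.univ)
    (hBne : B.Nonempty) (hiso : ∀ i ∈ A, ∀ j, Adj i j = true → j ∈ A)
    (hBsc : ∀ i ∈ B, ∀ j ∈ B,
      Relation.ReflTransGen (fun p q => p ∈ B ∧ q ∈ B ∧ Adj p q = true) i j) :
    IsolatedSplit (edgeWeight Adj a) A B := by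
  have hpos : ∀ {i j}, Adj i j = true → 0 < edgeWeight Adj a i j := fun {i j} h => by
    rw [edgeWeight, if_pos h]; exact ha i j h
  have hnn : ∀ i j, 0 ≤ edgeWeight Adj a i j := fun i j => by
    by_cases h : Adj i j = true
    · exact (hpos h).le
    · rw [edgeWeight, if_neg h]
  have hmem : ∀ k, k ∉ A → k ∈ B := fun k hk =>
    (Finset.mem_union.1 (hcover ▸ Finset.mem_univ k)).resolve_left hk
  refine ⟨hnn, hdisj, hcover, hBne, fun i hi j hj => if_neg fun h => hj (hiso i hi j h), ?_, ?_⟩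
  · rintro ⟨i, hi⟩ ⟨j, hj⟩
    induction hBsc i hi j hj with
    | refl => exact .refl
    | tail _ hpq ih => exact (ih hpq.1).tail (hpos hpq.2.2)
  · rintro ⟨a₀, ha₀⟩
    obtain ⟨r, hr⟩ := htree
    have hstay : ∀ {i j}, Relation.ReflTransGen (fun p q => Adj p q = true) i j → i ∈ A →
        j ∈ A := fun h hi => by
      induction h with
      | refl => exact hi
      | tail _ hpq ih => exact hiso _ ih _ hpq
    have hrA : r ∈ A := hstay (hr a₀) ha₀
    obtain ⟨b₀, hb₀⟩ := hBne
    have hedge : ∃ i ∈ B, ∃ j ∈ A, Adj i j = true := by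
      have hb₁ : b₀ ∉ A := Finset.disjoint_right.1 hdisj hb₀
      induction hr b₀ using Relation.ReflTransGen.head_induction_on with
      | refl => exact absurd hrA hb₁
      | @head p q hpq _ ih =>
        by_cases hq : q ∈ A
        · exact ⟨p, hb₀, q, hq, hpq⟩
        · exact ih (hmem q hq) hq
    obtain ⟨i, hi, j, hj, hij⟩ := hedge
    exact ⟨⟨i, hi⟩, ((hpos hij).trans_le
      (Finset.single_le_sum (f := fun j => edgeWeight Adj a i j) (fun j _ => hnn i j) hj)).ne.symm⟩

/-- The diameter of `S` is bounded along a solution up to any finite time strictly inside its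
interval of existence. -/
theorem IsSolOnSub.exists_DmaxSub_le {k : ℝ} {S : Finset (Fin n)}
    {x : ℝ → Fin n → Fin 2 → ℝ} {θ : ℝ → Fin n → ℝ} {T : ℝ≥0∞}
    (h : IsSolOnSub Adj a k S x θ T) {τ : ℝ} (hτ : ENNReal.ofReal τ < T) :
    ∃ m : ℝ, ∀ t, 0 ≤ t → t ≤ τ → DmaxSub S (x t) ≤ m := by
  have hbd : ∀ i ∈ S, ∃ m, ∀ t ∈ Icc 0 τ, ‖planePos (x t) i‖ ≤ m := fun i hi =>
    isCompact_Icc.exists_bound_of_continuousOn fun t ht =>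
      ((h.hasDerivWithinAt_planePos ht.1 ((ENNReal.ofReal_le_ofReal ht.2).trans_lt hτ)
        hi).continuousWithinAt).mono Icc_subset_Ici_self
  choose! m hm using hbd
  have hm0 : ∀ i ∈ S, ∀ t, 0 ≤ t → t ≤ τ → ‖planePos (x t) i‖ ≤ ∑ j ∈ S, |m j| :=
    fun i hi t h0 h1 => ((hm i hi t ⟨h0, h1⟩).trans (le_abs_self _)).trans
      (Finset.single_le_sum (f := fun j => |m j|) (fun j _ => abs_nonneg _) hi)
  have hs : 0 ≤ ∑ j ∈ S, |m j| := Finset.sum_nonneg fun j _ => abs_nonneg _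
  refine ⟨∑ j ∈ S, |m j| + ∑ j ∈ S, |m j|, fun t h0 h1 => DmaxSub_le (by positivity) ?_⟩
  exact fun i hi j hj => (norm_sub_le _ _).trans (add_le_add (hm0 i hi t h0 h1) (hm0 j hj t h0 h1))

/-- The leader-follower argument, with the strong connectivity and reachability hypotheses
summarised by `IsolatedSplit`. -/
theorem exists_gain_of_isolatedSplit {A B : Finset (Fin n)}
    (hS : IsolatedSplit (edgeWeight Adj a) A B) :
    ∃ k0 : ℝ, ∀ k, k0 ≤ k → RendezvousGAS Adj a k A → RendezvousGAS Adj a k Finset.univ := by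
  obtain ⟨k0, K, R, V, hK, hR, hVdiam, hVle, hVder⟩ :=
    hS.exists_lyapunov (E := EuclideanSpace ℝ (Fin 2))
  refine ⟨k0, fun k hk ⟨hstabA, hattrA⟩ => ?_⟩
  have hder : ∀ {x : ℝ → Fin n → Fin 2 → ℝ} {θ : ℝ → Fin n → ℝ} {T : ℝ≥0∞},
      IsSolOnSub Adj a k Finset.univ x θ T → ∃ V' : ℝ → ℝ, ∀ t, 0 ≤ t → ENNReal.ofReal t < T →
        HasDerivWithinAt (fun r => V (planePos (x r)) fun i => heading (θ r i)) (V' t) (Ici 0) t ∧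
        ∀ m, 0 < m → DmaxSub A (x t) ≤ m →
          K * m ^ 3 ≤ V (planePos (x t)) (fun i => heading (θ t i)) → V' t ≤ -m ^ 4 := by
    intro x θ T hsol
    have h : ∀ t, 0 ≤ t → ENNReal.ofReal t < T → ∃ V' : ℝ,
        HasDerivWithinAt (fun r => V (planePos (x r)) fun i => heading (θ r i)) V' (Ici 0) t ∧
        ∀ m, 0 < m → DmaxSub A (x t) ≤ m →
          K * m ^ 3 ≤ V (planePos (x t)) (fun i => heading (θ t i)) → V' ≤ -m ^ 4 := by
      intro t ht htT
      obtain ⟨V', h1, h2⟩ := hVder k (fun r => planePos (x r)) (fun r i => heading (θ r i))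
        (fun i => headingNormal (θ t i)) (Ici 0) t hk (fun i => norm_heading _)
        (fun i => norm_headingNormal _) (fun i u => eq_inner_heading_smul_add u _)
        (fun i => hsol.hasDerivWithinAt_planePos ht htT (Finset.mem_univ i))
        (fun i => hsol.hasDerivWithinAt_heading ht htT (Finset.mem_univ i))
      exact ⟨V', h1, fun m hm hA => h2 m hm fun i hi j hj =>
        (norm_sub_le_DmaxSub _ hi hj).trans hA⟩
    choose! V' hV' using h
    exact ⟨V', hV'⟩
  have hdiam : ∀ {x : Fin n → Fin 2 → ℝ} {θ : Fin n → ℝ} {m : ℝ}, 0 < m →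
      V (planePos x) (fun i => heading (θ i)) ≤ K * m ^ 3 → DmaxSub A x ≤ m →
      DmaxSub Finset.univ x ≤ R * m := fun {x θ m} hm hVm hA =>
    DmaxSub_le (by positivity) fun i _ j _ => hVdiam _ _ m hm.le (fun i => norm_heading _) hVm
      (fun i hi j hj => (norm_sub_le_DmaxSub x hi hj).trans hA) i j
  have hbarrier : ∀ {x : ℝ → Fin n → Fin 2 → ℝ} {θ : ℝ → Fin n → ℝ} {T : ℝ≥0∞} {m t : ℝ},
      IsSolOnSub Adj a k Finset.univ x θ T → 0 < m →
      V (planePos (x 0)) (fun i => heading (θ 0 i)) ≤ K * m ^ 3 → 0 ≤ t → ENNReal.ofReal t < T →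
      (∀ s, 0 ≤ s → s ≤ t → DmaxSub A (x s) ≤ m) → DmaxSub Finset.univ (x t) ≤ R * m := by
    intro x θ T m t hsol hm hV0 ht htT hA
    obtain ⟨V', hV'⟩ := hder hsol
    have hsT : ∀ s, s ≤ t → ENNReal.ofReal s < T := fun s hs =>
      (ENNReal.ofReal_le_ofReal hs).trans_lt htT
    have h := le_level_of_deriv_neg (V' := V')
      (V := fun r => V (planePos (x r)) fun i => heading (θ r i))
      (fun s hs => (hV' s hs.1 (hsT s hs.2)).1) hV0
      (fun s hs hsL => ((hV' s hs.1 (hsT s hs.2)).2 m hm (hA s hs.1 hs.2) hsL.ge).trans_lt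
        (neg_neg_of_pos (by positivity))) t ⟨ht, le_rfl⟩
    exact hdiam hm h (hA t ht le_rfl)
  refine ⟨fun ε hε => ?_, fun x θ T hmax => ?_⟩
  · have hm : 0 < ε / (2 * R) := by positivity
    set m := ε / (2 * R) with hm_def
    obtain ⟨δ, hδ, hδA⟩ := hstabA m hm
    set q := min 1 (K / R) with hq
    have hq0 : 0 < q := lt_min one_pos (by positivity)
    refine ⟨min δ (m * q), lt_min hδ (by positivity), fun x θ T hsol hx0 t ht htT => ?_⟩
    have hA : ∀ s, 0 ≤ s → s ≤ t → DmaxSub A (x s) ≤ m := fun s hs hst =>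
      (hδA x θ T (hsol.mono (Finset.subset_univ A))
        ((DmaxSub_mono (Finset.subset_univ A) _).trans_lt (hx0.trans_le (min_le_left _ _))) s hs
        ((ENNReal.ofReal_le_ofReal hst).trans_lt htT)).le
    have hV0 : V (planePos (x 0)) (fun i => heading (θ 0 i)) ≤ K * m ^ 3 := by
      refine (hVle _ _ (m * q) (by positivity) (fun i => norm_heading _) fun i j =>
        (norm_sub_le_DmaxSub (x 0) (Finset.mem_univ i) (Finset.mem_univ j)).trans
          (hx0.le.trans (min_le_right _ _))).trans ?_
      have h1 : q ^ 3 ≤ q := pow_le_of_le_one hq0.le (min_le_left _ _) three_ne_zero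
      have h2 : R * q ≤ K := by
        rw [mul_comm, ← le_div_iff₀ hR]; exact min_le_right _ _
      calc R * (m * q) ^ 3 = R * q ^ 3 * m ^ 3 := by ring
        _ ≤ R * q * m ^ 3 := by gcongr
        _ ≤ K * m ^ 3 := by gcongr
    refine (hbarrier hsol hm hV0 ht htT hA).trans_lt ?_
    have h3 : R * m = ε / 2 := by rw [hm_def]; field_simp
    linarith
  · have hsol := hmax.1
    have hsolA := hsol.mono (Finset.subset_univ A)
    have hTtop : T = ⊤ := by
      by_contra hT
      have hnmax : ¬IsMaxSolSub Adj a k A x θ T := fun h => hT (hattrA x θ T h).1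
      obtain ⟨x', θ', T', hTT', hsol', heq⟩ : ∃ x' θ' T', T < T' ∧ IsSolOnSub Adj a k A x' θ' T' ∧
          ∀ t : ℝ, 0 ≤ t → ENNReal.ofReal t < T → ∀ i ∈ A, x' t i = x t i ∧ θ' t i = θ t i := by
        by_contra hcon
        exact hnmax ⟨hsolA, fun x' θ' T' h1 h2 h3 => hcon ⟨x', θ', T', h1, h2, h3⟩⟩
      obtain ⟨m₀, hm₀⟩ := hsol'.exists_DmaxSub_le (τ := T.toReal)
        (by rwa [ENNReal.ofReal_toReal hT])
      set v := V (planePos (x 0)) (fun i => heading (θ 0 i)) with hv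
      set m := 1 + |m₀| + |v| / K with hm_def
      have hm1 : 1 ≤ m := by
        rw [hm_def, add_assoc]; exact le_add_of_nonneg_right (by positivity)
      have hm : 0 < m := one_pos.trans_le hm1
      have hmv : v ≤ K * m ^ 3 := by
        have h1 : |v| / K ≤ m := by
          rw [hm_def]; exact le_add_of_nonneg_left (by positivity)
        have h2 : m ≤ m ^ 3 := le_self_pow₀ hm1 three_ne_zero
        rw [div_le_iff₀ hK] at h1
        calc v ≤ m * K := (le_abs_self v).trans h1
          _ ≤ m ^ 3 * K := by gcongr
          _ = K * m ^ 3 := mul_comm _ _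
      have hmA : ∀ t, 0 ≤ t → ENNReal.ofReal t < T → DmaxSub A (x t) ≤ m := fun t ht htT => by
        have h1 := hm₀ t ht ((ENNReal.ofReal_lt_iff_lt_toReal ht hT).1 htT).le
        have h2 : DmaxSub A (x t) ≤ DmaxSub A (x' t) :=
          DmaxSub_le (DmaxSub_nonneg _ _) fun i hi j hj => by
            have h3 := norm_sub_le_DmaxSub (x' t) hi hj
            rwa [planePos, planePos, (heq t ht htT i hi).1, (heq t ht htT j hj).1] at h3
        have h4 : |m₀| ≤ m := by
          have : 0 ≤ |v| / K := by positivity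
          rw [hm_def]; linarith
        exact (h2.trans h1).trans ((le_abs_self _).trans h4)
      refine not_isMaxSolSub_of_bounded Adj a hT
        (M := (∑ i, ∑ j, edgeWeight Adj a i j) * (R * m)) (fun t ht htT i => ?_) hmax
      rw [enorm2_eq_norm, toLp_fcons]
      refine hS.norm_consensus_le (by positivity) (fun i j => ?_) i
      exact (norm_sub_le_DmaxSub (x t) (Finset.mem_univ i) (Finset.mem_univ j)).trans
        (hbarrier hsol hm hmv ht htT fun s hs hst =>
          hmA s hs ((ENNReal.ofReal_le_ofReal hst).trans_lt htT))
    subst hTtop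
    refine ⟨rfl, ?_⟩
    have hA := (hattrA x θ ⊤ ⟨hsolA, fun _ _ _ h => absurd h not_top_lt⟩).2
    obtain ⟨V', hV'⟩ := hder hsol
    refine Metric.tendsto_nhds.2 fun ε hε => ?_
    have hm : 0 < ε / (2 * R) := by positivity
    set m := ε / (2 * R) with hm_def
    have hAm : ∀ᶠ t in atTop, DmaxSub A (x t) < m := hA.eventually_lt_const hm
    obtain ⟨t₀, ht₀⟩ := eventually_atTop.1 (hAm.and (eventually_ge_atTop 0))
    have h0 : 0 ≤ t₀ := (ht₀ t₀ le_rfl).2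
    have hVm := eventually_le_level_of_deriv_le_neg (V' := V') (a := t₀) (L := K * m ^ 3)
      (κ := m ^ 4) (V := fun r => V (planePos (x r)) fun i => heading (θ r i)) (by positivity)
      (fun t ht => (hV' t (h0.trans ht) ENNReal.ofReal_lt_top).1.mono (Ici_subset_Ici.2 h0))
      (fun t ht hL => (hV' t (h0.trans ht) ENNReal.ofReal_lt_top).2 m hm (ht₀ t ht).1.le hL)
    filter_upwards [hVm, hAm] with t h1 h2
    rw [Real.dist_eq, sub_zero, abs_of_nonneg (DmaxSub_nonneg _ _)]
    refine (hdiam hm h1 h2.le).trans_lt ?_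
    have h3 : R * m = ε / 2 := by rw [hm_def]; field_simp
    linarith

end Rendezvous

/-- the induction step: let the digraph contain a reverse directed
spanning tree, with `V = A ∪ B` disjoint, `B` nonempty, `A` isolated, and the
induced subgraph on `B` strongly connected.  If for some `l ≥ 0` and all gains
`k1 > l` the rendezvous set of the (autonomous) subsystem `Σ_A` is globally
asymptotically stable, then there is `k1* ≥ l` such that for all `k1 > k1*` the
rendezvous set of the full system is globally asymptotically stable. -/
theorem rendezvous_induction_step {n : ℕ} (Adj : Fin n → Fin n → Bool)
    (hloop : ∀ i, Adj i i = false)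
    (a : Fin n → Fin n → ℝ) (ha : ∀ i j, Adj i j = true → 0 < a i j)
    (htree : ∃ r : Fin n, ∀ i, Relation.ReflTransGen (fun p q => Adj p q = true) i r)
    (A B : Finset (Fin n)) (hdisj : Disjoint A B) (hcover : A ∪ B = Finset.univ)
    (hBne : B.Nonempty)
    (hiso : ∀ i ∈ A, ∀ j, Adj i j = true → j ∈ A)
    (hBsc : ∀ i ∈ B, ∀ j ∈ B,
      Relation.ReflTransGen (fun p q => p ∈ B ∧ q ∈ B ∧ Adj p q = true) i j)
    (l : ℝ) (hl : 0 ≤ l)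
    (hGASA : ∀ k1 : ℝ, l < k1 → RendezvousGAS Adj a k1 A) :
    ∃ k1s : ℝ, l ≤ k1s ∧ ∀ k1 : ℝ, k1s < k1 →
      RendezvousGAS Adj a k1 Finset.univ := by
  obtain ⟨k0, hk0⟩ := exists_gain_of_isolatedSplit
    (isolatedSplit_edgeWeight ha htree hdisj hcover hBne hiso hBsc)
  exact ⟨max l k0, le_max_left _ _, fun k1 hk1 => hk0 k1 ((le_max_right _ _).trans hk1.le)
    (hGASA k1 ((le_max_left _ _).trans_lt hk1))⟩
end

section
/- Let G be a digraph on n vertices with no self-loops. The following are equivalent: (i) G contains a reverse directed spanning tree, i.e., there exists a vertex r such that every vertex has a directed path (along edge directions) to r; (ii) for every set of positive weights a_{ij} > 0 (j ∈ N_i, i = 1,…,n), the associated weighted Laplacian L of G has rank n − 1 and its kernel is the span of the all-ones vector 𝟙 ∈ ℝⁿ. -/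
open scoped BigOperators

/-- The weighted Laplacian `L = D - A` of a digraph with edge relation `Adj` and
weights `a`. -/
noncomputable def lap {n : ℕ} (Adj : Fin n → Fin n → Bool) (a : Fin n → Fin n → ℝ) :
    Matrix (Fin n) (Fin n) ℝ :=
  Matrix.diagonal (fun i => ∑ j, if Adj i j = true then a i j else 0) -
    Matrix.of fun i j => if Adj i j = true then a i j else 0

/-- The Laplacian acts by weighted sums of differences along the outgoing edges. -/
lemma lap_mulVec_apply {n : ℕ} (Adj : Fin n → Fin n → Bool) (a : Fin n → Fin n → ℝ)
    (x : Fin n → ℝ) (i : Fin n) :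
    (lap Adj a).mulVec x i = ∑ j, if Adj i j = true then a i j * (x i - x j) else 0 := by
  rw [lap, Matrix.sub_mulVec, Pi.sub_apply, Matrix.mulVec_diagonal, Finset.sum_mul,
    Matrix.mulVec, dotProduct, ← Finset.sum_sub_distrib]
  refine Finset.sum_congr rfl fun j _ => ?_
  by_cases h : Adj i j = true <;> simp [h, mul_sub]

/-- Maximum principle: a vector in the kernel of the Laplacian attains its maximum at every
vertex reachable from all the others. -/
lemma le_root_of_lap_mulVec_eq_zero {n : ℕ} {Adj : Fin n → Fin n → Bool}
    {a : Fin n → Fin n → ℝ} (ha : ∀ i j, Adj i j = true → 0 < a i j) {r : Fin n}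
    (hr : ∀ i, Relation.ReflTransGen (fun p q => Adj p q = true) i r) {x : Fin n → ℝ}
    (hx : (lap Adj a).mulVec x = 0) (k : Fin n) : x k ≤ x r := by
  have : Nonempty (Fin n) := ⟨r⟩
  obtain ⟨m, hm⟩ := Finite.exists_max x
  suffices h : ∀ q, Relation.ReflTransGen (fun p q => Adj p q = true) m q → x q = x m from
    (hm k).trans_eq (h r (hr m)).symm
  intro q hq
  induction hq with
  | refl => rfl
  | @tail p q _ hpq ih =>
    have hsum := congrFun hx p
    rw [lap_mulVec_apply, Pi.zero_apply, Finset.sum_eq_zero_iff_of_nonneg] at hsum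
    · have hq := hsum q (Finset.mem_univ q)
      rw [if_pos hpq, mul_eq_zero, sub_eq_zero] at hq
      exact (hq.resolve_left (ha p q hpq).ne').symm.trans ih
    · intro j _
      split_ifs with hj
      · exact mul_nonneg (ha p j hj).le (sub_nonneg.2 (ih ▸ hm j))
      · exact le_rfl

/-- Constant vectors lie in the kernel of the Laplacian. -/
lemma lap_mulVec_const {n : ℕ} (Adj : Fin n → Fin n → Bool) (a : Fin n → Fin n → ℝ) (c : ℝ) :
    (lap Adj a).mulVec (fun _ => c) = 0 := by
  ext i
  simp [lap_mulVec_apply]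

/-- If some vertex is reachable from all the others, the kernel of the Laplacian is spanned by
the all-ones vector. -/
lemma ker_lap_eq_span_one {n : ℕ} {Adj : Fin n → Fin n → Bool}
    {a : Fin n → Fin n → ℝ} (ha : ∀ i j, Adj i j = true → 0 < a i j) {r : Fin n}
    (hr : ∀ i, Relation.ReflTransGen (fun p q => Adj p q = true) i r) :
    LinearMap.ker (Matrix.mulVecLin (lap Adj a)) =
      Submodule.span ℝ {(fun _ => (1 : ℝ) : Fin n → ℝ)} := by
  ext x
  rw [LinearMap.mem_ker, Matrix.mulVecLin_apply, Submodule.mem_span_singleton]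
  constructor
  · intro hx
    have hneg : (lap Adj a).mulVec (-x) = 0 := by rw [Matrix.mulVec_neg, hx, neg_zero]
    refine ⟨x r, funext fun k => ?_⟩
    have h₁ := le_root_of_lap_mulVec_eq_zero ha hr hx k
    have h₂ := le_root_of_lap_mulVec_eq_zero ha hr hneg k
    simp only [Pi.neg_apply, neg_le_neg_iff] at h₂
    simpa using le_antisymm h₂ h₁
  · rintro ⟨c, rfl⟩
    rw [Matrix.mulVec_smul, lap_mulVec_const, smul_zero]

/-- A matrix whose kernel is a line spanned by the all-ones vector has corank one. -/
lemma rank_eq_of_ker_eq_span_one {n : ℕ} (hn : 0 < n) {M : Matrix (Fin n) (Fin n) ℝ}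
    (hM : LinearMap.ker M.mulVecLin = Submodule.span ℝ {(fun _ => (1 : ℝ) : Fin n → ℝ)}) :
    M.rank = n - 1 := by
  have hone : (fun _ => (1 : ℝ) : Fin n → ℝ) ≠ 0 := fun h => one_ne_zero (congrFun h ⟨0, hn⟩)
  have h := M.mulVecLin.finrank_range_add_finrank_ker
  rw [hM, finrank_span_singleton hone, Module.finrank_fin_fun] at h
  exact Nat.eq_sub_of_add_eq h

/-- If the kernel of the Laplacian is spanned by the all-ones vector, any two vertices can reach
a common vertex. -/
lemma exists_common_reachable {n : ℕ} {Adj : Fin n → Fin n → Bool} {a : Fin n → Fin n → ℝ}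
    (hker : LinearMap.ker (Matrix.mulVecLin (lap Adj a)) =
      Submodule.span ℝ {(fun _ => (1 : ℝ) : Fin n → ℝ)}) (p q : Fin n) :
    ∃ k, Relation.ReflTransGen (fun p q => Adj p q = true) p k ∧
      Relation.ReflTransGen (fun p q => Adj p q = true) q k := by
  classical
  by_contra! hdisj
  set R := Relation.ReflTransGen (fun p q => Adj p q = true)
  -- Solutions of `T x = 0` are constant on the vertices reachable from `p`, vanish on those
  -- reachable from `q`, and are harmonic elsewhere.
  let coord (i : Fin n) : (Fin n → ℝ) →ₗ[ℝ] ℝ := LinearMap.proj i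
  let T : (Fin n → ℝ) →ₗ[ℝ] (Fin n → ℝ) := LinearMap.pi fun i =>
    if R p i then coord i - coord p
    else if R q i then coord i
    else coord i ∘ₗ Matrix.mulVecLin (lap Adj a)
  have hTp : ∀ x i, R p i → T x i = x i - x p := fun x i h => by simp [T, coord, h]
  have hTq : ∀ x i, R q i → T x i = x i := fun x i h => by
    have h' : ¬ R p i := fun hp => hdisj i hp h
    simp [T, coord, h, h']
  have hTu : ∀ x i, ¬ R p i → ¬ R q i → T x i = (lap Adj a).mulVec x i := fun x i h h' => by
    simp [T, coord, h, h']
  have hsurj : ¬ Function.Surjective T := fun h => by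
    obtain ⟨x, hx⟩ := h fun _ => 1
    have := congrFun hx p
    rw [hTp x p .refl, sub_self] at this
    exact zero_ne_one this
  rw [← LinearMap.injective_iff_surjective, injective_iff_map_eq_zero] at hsurj
  push Not at hsurj
  obtain ⟨x, hx, hx0⟩ := hsurj
  have hxp : ∀ i, R p i → x i = x p := fun i h => by
    rw [← sub_eq_zero, ← hTp x i h, hx, Pi.zero_apply]
  have hxq : ∀ i, R q i → x i = 0 := fun i h => by rw [← hTq x i h, hx, Pi.zero_apply]
  have hmem : x ∈ LinearMap.ker (Matrix.mulVecLin (lap Adj a)) := by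
    rw [LinearMap.mem_ker, Matrix.mulVecLin_apply]
    ext i
    by_cases hp : R p i
    · rw [lap_mulVec_apply, Pi.zero_apply]
      refine Finset.sum_eq_zero fun j _ => ?_
      split_ifs with hj
      · rw [hxp i hp, hxp j (hp.tail hj), sub_self, mul_zero]
      · rfl
    by_cases hq : R q i
    · rw [lap_mulVec_apply, Pi.zero_apply]
      refine Finset.sum_eq_zero fun j _ => ?_
      split_ifs with hj
      · rw [hxq i hq, hxq j (hq.tail hj), sub_self, mul_zero]
      · rfl
    rw [← hTu x i hp hq, hx]
  rw [hker, Submodule.mem_span_singleton] at hmem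
  obtain ⟨c, rfl⟩ := hmem
  have hc : c = 0 := by simpa using hxq q .refl
  exact hx0 (by rw [hc, zero_smul])

/-- a digraph (no self-loops) contains a reverse directed spanning tree
(there is a vertex reachable from every vertex) iff for every choice of positive
weights the weighted Laplacian has rank `n - 1` and kernel spanned by the all-ones
vector. -/
theorem laplacian_rank_iff_reverse_spanning_tree {n : ℕ} (hn : 0 < n)
    (Adj : Fin n → Fin n → Bool) (hloop : ∀ i, Adj i i = false) :
    (∃ r : Fin n, ∀ i, Relation.ReflTransGen (fun p q => Adj p q = true) i r) ↔
      (∀ a : Fin n → Fin n → ℝ, (∀ i j, Adj i j = true → 0 < a i j) →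
        (lap Adj a).rank = n - 1 ∧
        LinearMap.ker (Matrix.mulVecLin (lap Adj a)) =
          Submodule.span ℝ {(fun _ => (1 : ℝ) : Fin n → ℝ)}) := by
  constructor
  · rintro ⟨r, hr⟩ a ha
    have hker := ker_lap_eq_span_one ha hr
    exact ⟨rank_eq_of_ker_eq_span_one hn hker, hker⟩
  · intro h
    have : Nonempty (Fin n) := ⟨⟨0, hn⟩⟩
    have hker := (h (fun _ _ => 1) fun _ _ _ => one_pos).2
    have hdir : Directed (Relation.ReflTransGen fun p q => Adj p q = true) (id : Fin n → Fin n) :=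
      exists_common_reachable hker
    exact hdir.finite_le id
end

section
/- Let (M,d) be a proper metric space (closed bounded subsets are compact) and φ : [0,∞) × M → M a continuous semiflow (φ(0,p) = p and φ(t+s,p) = φ(t,φ(s,p)) for all t,s ≥ 0, p ∈ M). Let Γ₁ ⊆ Γ₂ ⊆ M be closed sets that are positively invariant (φ(t,Γ_k) ⊆ Γ_k for all t ≥ 0), with Γ₁ compact. Suppose: (i)' Γ₁ is globally asymptotically stable relative to Γ₂, i.e., for every ε > 0 there is δ > 0 such that for all p ∈ Γ₂ with ‖p‖_{Γ₁} < δ one has ‖φ(t,p)‖_{Γ₁} < ε for all t ≥ 0, and for every p ∈ Γ₂, ‖φ(t,p)‖_{Γ₁} → 0 as t → ∞; (ii) Γ₂ is locally stable near Γ₁, i.e., for all c > 0 and ε > 0 there is δ > 0 such that for every p with ‖p‖_{Γ₁} < δ and every t* > 0, if ‖φ(s,p)‖_{Γ₁} < c for all s ∈ [0,t*] then ‖φ(s,p)‖_{Γ₂} < ε for all s ∈ [0,t*]; (iii)' Γ₂ is globally attractive, i.e., ‖φ(t,p)‖_{Γ₂} → 0 as t → ∞ for every p ∈ M; (iv) every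 trajectory {φ(t,p) : t ≥ 0} is bounded. Then Γ₁ is globally asymptotically stable: for every ε > 0 there is δ > 0 such that ‖p‖_{Γ₁} < δ implies ‖φ(t,p)‖_{Γ₁} < ε for all t ≥ 0, and ‖φ(t,p)‖_{Γ₁} → 0 as t → ∞ for every p ∈ M. -/
open Metric Filter

/-- Uniform attraction of compact subsets of `Γ₂` to a set `Γ₁` that is asymptotically stable
relative to `Γ₂`. -/
theorem exists_uniform_attraction_time {M : Type*} [MetricSpace M] {φ : NNReal → M → M}
    (hcont : ∀ t, Continuous (φ t)) (hφadd : ∀ t s p, φ (t + s) p = φ t (φ s p))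
    {Γ₁ Γ₂ : Set M} (hinv₂ : ∀ t p, p ∈ Γ₂ → φ t p ∈ Γ₂)
    (hstab : ∀ ε > (0 : ℝ), ∃ δ > (0 : ℝ), ∀ p ∈ Γ₂, infDist p Γ₁ < δ →
      ∀ t, infDist (φ t p) Γ₁ < ε)
    (hattr : ∀ p ∈ Γ₂, Tendsto (fun t => infDist (φ t p) Γ₁) atTop (nhds 0))
    {C : Set M} (hC : IsCompact C) (hCΓ : C ⊆ Γ₂) {ε : ℝ} (hε : 0 < ε) :
    ∃ T : NNReal, ∀ p ∈ C, ∀ t ≥ T, infDist (φ t p) Γ₁ < ε := by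
  obtain ⟨δ, hδ, hδε⟩ := hstab ε hε
  suffices h : ∃ T : NNReal, ∀ p ∈ C, p ∈ Γ₂ → ∀ t ≥ T, infDist (φ t p) Γ₁ < ε by
    obtain ⟨T, hT⟩ := h
    exact ⟨T, fun p hp => hT p hp (hCΓ hp)⟩
  refine hC.induction_on
    (p := fun s => ∃ T : NNReal, ∀ p ∈ s, p ∈ Γ₂ → ∀ t ≥ T, infDist (φ t p) Γ₁ < ε)
    ⟨0, by simp⟩ ?_ ?_ ?_
  · rintro s s' hss ⟨T, hT⟩
    exact ⟨T, fun p hp => hT p (hss hp)⟩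
  · rintro s s' ⟨T, hT⟩ ⟨T', hT'⟩
    refine ⟨max T T', fun p hp hpΓ t ht => ?_⟩
    rcases hp with hp | hp
    · exact hT p hp hpΓ t ((le_max_left _ _).trans ht)
    · exact hT' p hp hpΓ t ((le_max_right _ _).trans ht)
  · intro x hx
    obtain ⟨T, hT⟩ := ((hattr x (hCΓ hx)).eventually_lt_const hδ).exists
    have hopen : IsOpen {y | infDist (φ T y) Γ₁ < δ} :=
      isOpen_lt ((continuous_infDist_pt Γ₁).comp (hcont T)) continuous_const
    refine ⟨_, mem_nhdsWithin_of_mem_nhds (hopen.mem_nhds hT), T, fun p hp hpΓ t ht => ?_⟩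
    rw [← tsub_add_cancel_of_le ht, hφadd]
    exact hδε _ (hinv₂ T p hpΓ) hp _

/-- A continuous function that is positive on a compact set has a positive lower bound there. -/
theorem IsCompact.exists_pos_forall_le {X : Type*} [TopologicalSpace X] {K : Set X}
    (hK : IsCompact K) {f : X → ℝ} (hf : Continuous f) (hpos : ∀ x ∈ K, 0 < f x) :
    ∃ η > 0, ∀ x ∈ K, η ≤ f x := by
  rcases K.eq_empty_or_nonempty with rfl | hne
  · exact ⟨1, one_pos, by simp⟩
  · obtain ⟨x, hx, hmin⟩ := hK.exists_isMinOn hne hf.continuousOn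
    exact ⟨f x, hpos x hx, fun y hy => hmin hy⟩

/-- Closed thickenings of a nonempty compact set in a proper space are compact. -/
theorem IsCompact.isCompact_infDist_le {M : Type*} [MetricSpace M] [ProperSpace M] {Γ : Set M}
    (hΓ : IsCompact Γ) (hne : Γ.Nonempty) (ε : ℝ) : IsCompact {x | infDist x Γ ≤ ε} := by
  refine isCompact_of_isClosed_isBounded
    (isClosed_le (continuous_infDist_pt Γ) continuous_const)
    ((hΓ.isBounded.thickening (δ := ε + 1)).subset fun x hx => ?_)
  rw [mem_thickening_iff_infDist_lt hne]
  exact lt_of_le_of_lt hx (lt_add_one ε)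

/-- Reduction theorem for compact attractors.  `φ` is a continuous
semiflow on a proper metric space `M`, `Γ₁ ⊆ Γ₂` are closed positively invariant
sets with `Γ₁` compact.  If `Γ₁` is GAS relative to `Γ₂`, `Γ₂` is locally stable
near `Γ₁`, `Γ₂` is globally attractive, and all trajectories are bounded, then
`Γ₁` is globally asymptotically stable. -/
theorem reduction_theorem {M : Type*} [MetricSpace M] [ProperSpace M]
    (φ : NNReal → M → M)
    (hcont : Continuous fun p : NNReal × M => φ p.1 p.2)
    (hφ0 : ∀ p, φ 0 p = p)
    (hφadd : ∀ t s p, φ (t + s) p = φ t (φ s p))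
    (Γ₁ Γ₂ : Set M) (hsub : Γ₁ ⊆ Γ₂)
    (hΓ₁cpt : IsCompact Γ₁) (hΓ₁cl : IsClosed Γ₁) (hΓ₂cl : IsClosed Γ₂)
    (hinv₁ : ∀ t p, p ∈ Γ₁ → φ t p ∈ Γ₁)
    (hinv₂ : ∀ t p, p ∈ Γ₂ → φ t p ∈ Γ₂)
    -- (i)' : Γ₁ is globally asymptotically stable relative to Γ₂
    (hstab_rel : ∀ ε > (0 : ℝ), ∃ δ > (0 : ℝ), ∀ p ∈ Γ₂, infDist p Γ₁ < δ →
        ∀ t, infDist (φ t p) Γ₁ < ε)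
    (hattr_rel : ∀ p ∈ Γ₂, Tendsto (fun t => infDist (φ t p) Γ₁) atTop (nhds 0))
    -- (ii) : Γ₂ is locally stable near Γ₁
    (hloc_stab : ∀ c > (0 : ℝ), ∀ ε > (0 : ℝ), ∃ δ > (0 : ℝ), ∀ p, infDist p Γ₁ < δ →
        ∀ tstar : NNReal, 0 < tstar →
          (∀ s ≤ tstar, infDist (φ s p) Γ₁ < c) →
          (∀ s ≤ tstar, infDist (φ s p) Γ₂ < ε))
    -- (iii)' : Γ₂ is globally attractive
    (hattr₂ : ∀ p, Tendsto (fun t => infDist (φ t p) Γ₂) atTop (nhds 0))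
    -- (iv) : all trajectories are bounded
    (hbdd : ∀ p, Bornology.IsBounded (Set.range fun t => φ t p)) :
    (∀ ε > (0 : ℝ), ∃ δ > (0 : ℝ), ∀ p, infDist p Γ₁ < δ →
        ∀ t, infDist (φ t p) Γ₁ < ε) ∧
    ∀ p, Tendsto (fun t => infDist (φ t p) Γ₁) atTop (nhds 0) := by
  rcases Γ₁.eq_empty_or_nonempty with rfl | hne
  · simp only [infDist_empty]
    exact ⟨fun ε hε => ⟨1, one_pos, fun _ _ _ => hε⟩, fun _ => tendsto_const_nhds⟩
  have hne₂ : Γ₂.Nonempty := hne.mono hsub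
  have hcont_pt : ∀ t, Continuous (φ t) := fun t =>
    hcont.comp (continuous_const.prodMk continuous_id)
  have hcont_time : ∀ p, Continuous fun t => φ t p := fun p =>
    hcont.comp (continuous_id.prodMk continuous_const)
  have hstab : ∀ ε > (0 : ℝ), ∃ δ > (0 : ℝ), ∀ p, infDist p Γ₁ < δ →
      ∀ t, infDist (φ t p) Γ₁ < ε := by
    intro ε hε
    have hK := hΓ₁cpt.isCompact_infDist_le hne ε
    obtain ⟨T₀, hT₀⟩ := exists_uniform_attraction_time hcont_pt hφadd hinv₂ hstab_rel hattr_rel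
      (hK.inter_right hΓ₂cl) Set.inter_subset_right hε
    obtain ⟨T, hTpos, hT⟩ : ∃ T : NNReal, 0 < T ∧
        ∀ p, infDist p Γ₁ ≤ ε → p ∈ Γ₂ → infDist (φ T p) Γ₁ < ε :=
      ⟨T₀ + 1, by positivity, fun p hp hpΓ => hT₀ p ⟨hp, hpΓ⟩ _ le_self_add⟩
    obtain ⟨η, hη, hηT⟩ := (hK.inter_right (isClosed_le continuous_const
      ((continuous_infDist_pt Γ₁).comp (hcont_pt T)) :
        IsClosed {x | ε ≤ infDist (φ T x) Γ₁})).exists_pos_forall_le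
      (continuous_infDist_pt Γ₂) (by
        rintro x ⟨hx, hxT⟩
        refine (hΓ₂cl.notMem_iff_infDist_pos hne₂).1 fun hxΓ => ?_
        exact (hT x hx hxΓ).not_ge hxT)
    obtain ⟨δ₁, hδ₁, hshort⟩ := (((isCompact_Icc (a := (0 : NNReal)) (b := T)).prod hK).inter_right
      (isClosed_le continuous_const ((continuous_infDist_pt Γ₁).comp hcont) :
        IsClosed {x : NNReal × M | ε ≤ infDist (φ x.1 x.2) Γ₁})).exists_pos_forall_le
      ((continuous_infDist_pt Γ₁).comp continuous_snd) (by
        rintro ⟨t, x⟩ ⟨-, hx⟩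
        refine (hΓ₁cl.notMem_iff_infDist_pos hne).1 fun hxΓ => ?_
        have h0 := infDist_zero_of_mem (hinv₁ t x hxΓ)
        simp only [Set.mem_ofPred_eq] at hx
        linarith)
    obtain ⟨δ₂, hδ₂, hloc⟩ := hloc_stab ε hε η hη
    refine ⟨min ε (min δ₁ δ₂), by positivity, fun p hp => ?_⟩
    obtain ⟨hpε, hp₁, hp₂⟩ : infDist p Γ₁ < ε ∧ infDist p Γ₁ < δ₁ ∧ infDist p Γ₁ < δ₂ := by
      simpa using hp
    by_contra! hexit
    have hclosed : IsClosed {t | ε ≤ infDist (φ t p) Γ₁} :=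
      isClosed_le continuous_const ((continuous_infDist_pt Γ₁).comp (hcont_time p))
    obtain ⟨t, ht, hfirst⟩ : ∃ t, ε ≤ infDist (φ t p) Γ₁ ∧
        ∀ s < t, infDist (φ s p) Γ₁ < ε :=
      ⟨_, hclosed.csInf_mem hexit (OrderBot.bddBelow _),
        fun s hs => not_le.1 fun h => notMem_of_lt_csInf hs (OrderBot.bddBelow _) h⟩
    have hTt : T < t := by
      by_contra! htT
      exact (hshort (t, p) ⟨⟨⟨zero_le, htT⟩, hpε.le⟩, ht⟩).not_gt hp₁
    have hlt : t - T < t := tsub_lt_self (hTpos.trans hTt) hTpos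
    have hnear := hloc p hp₂ (t - T) (tsub_pos_of_lt hTt)
      (fun s hs => hfirst s (hs.trans_lt hlt)) _ le_rfl
    refine (hηT (φ (t - T) p) ⟨(hfirst _ hlt).le, ?_⟩).not_gt hnear
    rwa [Set.mem_ofPred_eq, ← hφadd, add_tsub_cancel_of_le hTt.le]
  refine ⟨hstab, fun p => ?_⟩
  obtain ⟨q, -, hq⟩ := (hbdd p).isCompact_closure.exists_mapClusterPt (f := atTop)
    (u := fun t => φ t p)
    (tendsto_principal.2 <| Eventually.of_forall fun t => subset_closure (Set.mem_range_self t))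
  have hqΓ : q ∈ Γ₂ := by
    by_contra hqΓ
    have hpos := (hΓ₂cl.notMem_iff_infDist_pos hne₂).1 hqΓ
    have hopen : IsOpen {x | infDist q Γ₂ / 2 < infDist x Γ₂} :=
      isOpen_lt continuous_const (continuous_infDist_pt Γ₂)
    obtain ⟨t, ht, ht'⟩ := ((hq.frequently (hopen.mem_nhds (half_lt_self hpos))).and_eventually
      ((hattr₂ p).eventually_lt_const (half_pos hpos))).exists
    exact lt_asymm ht ht'
  rw [tendsto_order]
  refine ⟨fun a ha => Eventually.of_forall fun t => ha.trans_le infDist_nonneg, fun ε hε => ?_⟩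
  obtain ⟨δ, hδ, hδε⟩ := hstab ε hε
  obtain ⟨T, hT⟩ := ((hattr_rel q hqΓ).eventually_lt_const hδ).exists
  have hopen : IsOpen {y | infDist (φ T y) Γ₁ < δ} :=
    isOpen_lt ((continuous_infDist_pt Γ₁).comp (hcont_pt T)) continuous_const
  obtain ⟨s, hs⟩ := (hq.frequently (hopen.mem_nhds hT)).exists
  filter_upwards [eventually_ge_atTop (T + s)] with t ht
  rw [← tsub_add_cancel_of_le ht, hφadd, hφadd T s]
  exact hδε _ hs _
end

section
/- Let G be a digraph on n vertices with no self-loops containing a reverse directed spanning tree, with weights a_{ij} > 0. Then the linear consensus dynamics achieve rendezvous: for every differentiable curve x : [0,∞) → (ℝ²)ⁿ satisfying ẋ_i(t) = Σ_{j∈N_i} a_{ij}(x_j(t) − x_i(t)) for all i and all t ≥ 0, there exists a point x* ∈ ℝ² such that x_i(t) → x* as t → ∞ for every i. -/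
open scoped BigOperators

section NonnegativeSystems

open Set

variable {ι : Type*} [Fintype ι] {B : ι → ι → ℝ} {z : ℝ → ι → ℝ} {s : ℝ}

/-- A curve differentiable on `[s, ∞)` with derivative nonnegative on `(s, t)` does not decrease
between `s` and `t`. -/
lemma le_of_hasDerivWithinAt_nonneg {f f' : ℝ → ℝ} {s t : ℝ} (hst : s ≤ t)
    (hf : ∀ u, s ≤ u → HasDerivWithinAt f (f' u) (Ici s) u)
    (hf' : ∀ u, s < u → u < t → 0 ≤ f' u) : f s ≤ f t := by
  have hmono : MonotoneOn f (Icc s t) := by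
    refine monotoneOn_of_hasDerivWithinAt_nonneg (f' := f') (convex_Icc s t) ?_ ?_ ?_
    · exact fun u hu => ((hf u hu.1).continuousWithinAt).mono Icc_subset_Ici_self
    · rw [interior_Icc]
      exact fun u hu => (hf u hu.1.le).mono fun v hv => hv.1.le
    · rw [interior_Icc]
      exact fun u hu => hf' u hu.1 hu.2
  exact hmono (left_mem_Icc.2 hst) (right_mem_Icc.2 hst) hst

/-- Strict positivity is preserved by the differential inequality `z' ≥ B z` with `B ≥ 0`. -/
lemma pos_of_mul_le_deriv (hB : ∀ i j, 0 ≤ B i j) {z' : ℝ → ι → ℝ}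
    (hz : ∀ t, s ≤ t → ∀ i, HasDerivWithinAt (fun u => z u i) (z' t i) (Ici s) t)
    (hz' : ∀ t, s ≤ t → ∀ i, ∑ j, B i j * z t j ≤ z' t i)
    (h0 : ∀ i, 0 < z s i) {t : ℝ} (ht : s ≤ t) (i : ι) : 0 < z t i := by
  by_contra! hneg
  have hclosed : IsClosed (⋃ k, {u ∈ Icc s t | z u k ≤ 0}) := by
    refine isClosed_iUnion_of_finite fun k => ?_
    have hc : ContinuousOn (fun u => z u k) (Icc s t) :=
      fun u hu => ((hz u hu.1 k).continuousWithinAt).mono Icc_subset_Ici_self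
    exact hc.preimage_isClosed_of_isClosed isClosed_Icc isClosed_Iic
  have hcompact : IsCompact (⋃ k, {u ∈ Icc s t | z u k ≤ 0}) :=
    isCompact_Icc.of_isClosed_subset hclosed (iUnion_subset fun k => sep_subset _ _)
  obtain ⟨u, hu, hleast⟩ := hcompact.exists_isLeast
    ⟨t, mem_iUnion.2 ⟨i, right_mem_Icc.2 ht, hneg⟩⟩
  obtain ⟨k, hut, huk⟩ := mem_iUnion.1 hu
  have hpos : ∀ v, s < v → v < u → ∀ j, 0 < z v j := by
    intro v hsv hvu j
    by_contra! hv
    exact hvu.not_ge (hleast (mem_iUnion.2 ⟨j, ⟨hsv.le, hvu.le.trans hut.2⟩, hv⟩))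
  have hle : z s k ≤ z u k :=
    le_of_hasDerivWithinAt_nonneg (f := fun v => z v k) (f' := fun v => z' v k) hut.1
      (fun v hv => hz v hv k) fun v hsv hvu =>
        (Finset.sum_nonneg fun j _ => mul_nonneg (hB k j) (hpos v hsv hvu j).le).trans
          (hz' v hsv.le k)
  linarith [h0 k]

/-- Nonnegativity is preserved by the linear system `z' = B z` with `B ≥ 0`. -/
lemma nonneg_of_linear_system (hB : ∀ i j, 0 ≤ B i j)
    (hz : ∀ t, s ≤ t → ∀ i, HasDerivWithinAt (fun u => z u i) (∑ j, B i j * z t j) (Ici s) t)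
    (h0 : ∀ i, 0 ≤ z s i) {t : ℝ} (ht : s ≤ t) (i : ι) : 0 ≤ z t i := by
  set K := ∑ i, ∑ j, B i j
  have hrow : ∀ k, ∑ j, B k j ≤ K := fun k =>
    Finset.single_le_sum (f := fun k => ∑ j, B k j)
      (fun k _ => Finset.sum_nonneg fun j _ => hB k j) (Finset.mem_univ k)
  have hpert : ∀ δ : ℝ, 0 < δ → 0 < z t i + δ * Real.exp (K * t) := by
    intro δ hδ
    refine pos_of_mul_le_deriv (z := fun u k => z u k + δ * Real.exp (K * u))
      (z' := fun u k => ∑ j, B k j * z u j + δ * (Real.exp (K * u) * (K * 1)))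
      hB (s := s) ?_ ?_ ?_ ht i
    · intro u hu k
      exact (hz u hu k).add
        ((((hasDerivAt_id u).const_mul K).exp.const_mul δ).hasDerivWithinAt)
    · intro u hu k
      have hsplit : ∑ j, B k j * (z u j + δ * Real.exp (K * u))
          = ∑ j, B k j * z u j + (∑ j, B k j) * (δ * Real.exp (K * u)) := by
        simp only [mul_add, Finset.sum_add_distrib, Finset.sum_mul]
      have := mul_le_mul_of_nonneg_right (hrow k) (by positivity : 0 ≤ δ * Real.exp (K * u))
      rw [hsplit]
      linarith
    · intro k
      have := h0 k
      positivity
  by_contra! hneg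
  have := hpert (-z t i / Real.exp (K * t)) (div_pos (by linarith) (Real.exp_pos _))
  rw [div_mul_cancel₀ _ (Real.exp_pos _).ne'] at this
  linarith

/-- Along a path from `i` to `r` in the graph of positive entries of `B ≥ 0`, positivity of the
`r`-th coordinate propagates to the `i`-th one with uniform delay and gain. -/
lemma exists_gain_of_reachable (hB : ∀ i j, 0 ≤ B i j) {E : ι → ι → Prop}
    (hE : ∀ i j, E i j → 0 < B i j) {i r : ι} (hir : Relation.ReflTransGen E i r) :
    ∃ T ε : ℝ, 0 ≤ T ∧ 0 < ε ∧ ∀ (z : ℝ → ι → ℝ) (s : ℝ),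
      (∀ t, s ≤ t → ∀ i, HasDerivWithinAt (fun u => z u i) (∑ j, B i j * z t j) (Ici s) t) →
      (∀ i, 0 ≤ z s i) → ∀ t, s + T ≤ t → ε * z s r ≤ z t i := by
  induction hir using Relation.ReflTransGen.head_induction_on with
  | refl =>
    refine ⟨0, 1, le_rfl, one_pos, fun z s hz h0 t ht => ?_⟩
    rw [one_mul]
    exact le_of_hasDerivWithinAt_nonneg (f := fun u => z u r) (by linarith)
      (fun u hu => hz u hu r) fun u hu _ => Finset.sum_nonneg fun j _ =>
        mul_nonneg (hB r j) (nonneg_of_linear_system hB hz h0 hu.le j)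
  | @head i k hik _ ih =>
    obtain ⟨T, ε, hT, hε, H⟩ := ih
    refine ⟨T + 1, B i k * ε, by linarith, mul_pos (hE i k hik) hε, fun z s hz h0 t ht => ?_⟩
    have hnn : ∀ u, s ≤ u → ∀ j, 0 ≤ z u j :=
      fun u hu j => nonneg_of_linear_system hB hz h0 hu j
    have hc : 0 ≤ B i k * (ε * z s r) :=
      mul_nonneg (hB i k) (mul_nonneg hε.le (h0 r))
    have hgrow := le_of_hasDerivWithinAt_nonneg (s := s + T) (t := t)
      (f := fun u => z u i - B i k * (ε * z s r) * u)
      (f' := fun u => ∑ j, B i j * z u j - B i k * (ε * z s r) * 1) (by linarith)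
      (fun u hu => ((hz u (by linarith) i).mono (Ici_subset_Ici.2 (by linarith))).sub
        (((hasDerivAt_id u).const_mul _).hasDerivWithinAt))
      (fun u hu _ => by
        have hsingle : B i k * z u k ≤ ∑ j, B i j * z u j :=
          Finset.single_le_sum (f := fun j => B i j * z u j)
            (fun j _ => mul_nonneg (hB i j) (hnn u (by linarith) j)) (Finset.mem_univ k)
        have := mul_le_mul_of_nonneg_left (H z s hz h0 u hu.le) (hB i k)
        linarith)
    have h1 := hnn (s + T) (by linarith) i
    have h2 : B i k * (ε * z s r) * 1 ≤ B i k * (ε * z s r) * (t - (s + T)) :=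
      mul_le_mul_of_nonneg_left (by linarith) hc
    linarith

end NonnegativeSystems

section Consensus

open Set Filter

variable {ι : Type*} [Fintype ι]

/-- `y` solves the scalar linear consensus dynamics with weights `w` on `[s, ∞)`. -/
def IsConsensusSolution (w : ι → ι → ℝ) (y : ℝ → ι → ℝ) (s : ℝ) : Prop :=
  ∀ t, s ≤ t → ∀ i,
    HasDerivWithinAt (fun u => y u i) (∑ j, w i j * (y t j - y t i)) (Ici s) t

variable {w : ι → ι → ℝ} {y : ℝ → ι → ℝ} {s : ℝ}

lemma IsConsensusSolution.mono (h : IsConsensusSolution w y s) {s' : ℝ} (hs : s ≤ s') :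
    IsConsensusSolution w y s' :=
  fun t ht i => (h t (hs.trans ht) i).mono (Ici_subset_Ici.2 hs)

lemma IsConsensusSolution.neg (h : IsConsensusSolution w y s) :
    IsConsensusSolution w (fun t i => -y t i) s := by
  intro t ht i
  refine (h t ht i).neg.congr_deriv ?_
  rw [← Finset.sum_neg_distrib]
  exact Finset.sum_congr rfl fun j _ => by ring

/-- The total weight, a convenient bound for all out-degrees. -/
noncomputable def totalWeight (w : ι → ι → ℝ) : ℝ := ∑ i, ∑ j, w i j

open Classical in
/-- The nonnegative matrix `c I - L`, where `L` is the weighted Laplacian and `c` the total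
weight. -/
noncomputable def shiftedLaplacian (w : ι → ι → ℝ) (i j : ι) : ℝ :=
  w i j + if i = j then totalWeight w - ∑ k, w i k else 0

lemma le_shiftedLaplacian (hw : ∀ i j, 0 ≤ w i j) (i j : ι) :
    w i j ≤ shiftedLaplacian w i j := by
  have hrow : ∑ k, w i k ≤ totalWeight w :=
    Finset.single_le_sum (f := fun k => ∑ j, w k j)
      (fun k _ => Finset.sum_nonneg fun j _ => hw k j) (Finset.mem_univ i)
  unfold shiftedLaplacian
  split_ifs <;> linarith

/-- The exponential rescaling `e^{ct}(y - m)` of a consensus solution solves the linear system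
with matrix `c I - L`. -/
lemma IsConsensusSolution.rescale (h : IsConsensusSolution w y s) (m : ℝ) :
    ∀ t, s ≤ t → ∀ i,
      HasDerivWithinAt (fun u => Real.exp (totalWeight w * u) * (y u i - m))
        (∑ j, shiftedLaplacian w i j * (Real.exp (totalWeight w * t) * (y t j - m)))
        (Ici s) t := by
  intro t ht i
  have hexp : HasDerivWithinAt (fun u => Real.exp (totalWeight w * u))
      (Real.exp (totalWeight w * t) * (totalWeight w * 1)) (Ici s) t :=
    (((hasDerivAt_id t).const_mul (totalWeight w)).exp).hasDerivWithinAt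
  refine (hexp.mul ((h t ht i).sub_const m)).congr_deriv ?_
  have hdiff : ∑ j, w i j * (y t j - y t i)
      = ∑ j, w i j * (y t j - m) - (∑ j, w i j) * (y t i - m) := by
    rw [Finset.sum_mul, ← Finset.sum_sub_distrib]
    exact Finset.sum_congr rfl fun j _ => by ring
  have hsum : ∑ j, shiftedLaplacian w i j * (Real.exp (totalWeight w * t) * (y t j - m))
      = Real.exp (totalWeight w * t) * ∑ j, w i j * (y t j - m)
        + (totalWeight w - ∑ k, w i k) * (Real.exp (totalWeight w * t) * (y t i - m)) := by
    simp only [shiftedLaplacian, add_mul, Finset.sum_add_distrib, ite_mul, zero_mul,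
      Finset.mul_sum]
    congr 1
    · exact Finset.sum_congr rfl fun j _ => by ring
    · rw [Finset.sum_eq_single i (fun j _ hj => if_neg hj.symm) (by simp), if_pos rfl]
  rw [hdiff, hsum]
  ring

/-- Lower bounds of a consensus solution persist. -/
lemma IsConsensusSolution.le_of_le (hw : ∀ i j, 0 ≤ w i j) (h : IsConsensusSolution w y s)
    {m : ℝ} (hm : ∀ i, m ≤ y s i) {t : ℝ} (ht : s ≤ t) (i : ι) : m ≤ y t i := by
  have hnn := nonneg_of_linear_system
    (fun i j => (hw i j).trans (le_shiftedLaplacian hw i j)) (h.rescale m)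
    (fun k => mul_nonneg (Real.exp_pos _).le (sub_nonneg.2 (hm k))) ht i
  exact sub_nonneg.1 (nonneg_of_mul_nonneg_right hnn (Real.exp_pos _))

/-- If `r` is reachable from every vertex, then after a uniform time a lower bound of a consensus
solution improves by a uniform fraction of the gap at `r`. -/
lemma exists_uniform_gain (hw : ∀ i j, 0 ≤ w i j) {E : ι → ι → Prop}
    (hE : ∀ i j, E i j → 0 < w i j) {r : ι} (hr : ∀ i, Relation.ReflTransGen E i r) :
    ∃ T ε : ℝ, 0 ≤ T ∧ 0 < ε ∧ ε < 1 ∧ ∀ (y : ℝ → ι → ℝ) (s m : ℝ),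
      IsConsensusSolution w y s → (∀ i, m ≤ y s i) →
        ∀ i, m + ε * (y s r - m) ≤ y (s + T) i := by
  have hB : ∀ i j, 0 ≤ shiftedLaplacian w i j :=
    fun i j => (hw i j).trans (le_shiftedLaplacian hw i j)
  choose τ η hτ hη H using fun i => exists_gain_of_reachable hB
    (fun i j hij => (hE i j hij).trans_le (le_shiftedLaplacian hw i j)) (hr i)
  have : Nonempty ι := ⟨r⟩
  obtain ⟨k, hk⟩ := Finite.exists_min η
  set T := ∑ i, τ i
  have hT : ∀ i, τ i ≤ T := fun i =>
    Finset.single_le_sum (fun j _ => hτ j) (Finset.mem_univ i)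
  set c := totalWeight w
  refine ⟨T, min (η k * Real.exp (-(c * T))) (1 / 2), Finset.sum_nonneg fun i _ => hτ i,
    lt_min (mul_pos (hη k) (Real.exp_pos _)) (by norm_num),
    (min_le_right _ _).trans_lt (by norm_num), fun y s m h hm i => ?_⟩
  have hgap : 0 ≤ y s r - m := sub_nonneg.2 (hm r)
  have hgain := H i (fun u i => Real.exp (c * u) * (y u i - m)) s (h.rescale m)
    (fun j => mul_nonneg (Real.exp_pos _).le (sub_nonneg.2 (hm j))) (s + T)
    (by linarith [hT i])
  have hexp : Real.exp (c * s) = Real.exp (c * (s + T)) * Real.exp (-(c * T)) := by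
    rw [← Real.exp_add]
    ring_nf
  have hle : η i * (Real.exp (-(c * T)) * (y s r - m)) ≤ y (s + T) i - m := by
    refine le_of_mul_le_mul_left ?_ (Real.exp_pos (c * (s + T)))
    simp only [hexp] at hgain
    linarith
  have hmin : min (η k * Real.exp (-(c * T))) (1 / 2) * (y s r - m)
      ≤ η k * Real.exp (-(c * T)) * (y s r - m) :=
    mul_le_mul_of_nonneg_right (min_le_left _ _) hgap
  have hki : η k * (Real.exp (-(c * T)) * (y s r - m))
      ≤ η i * (Real.exp (-(c * T)) * (y s r - m)) :=
    mul_le_mul_of_nonneg_right (hk i) (mul_nonneg (Real.exp_pos _).le hgap)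
  linarith

/-- Scalar consensus: if some vertex is reachable from every vertex, all coordinates of a consensus
solution converge to a common limit. -/
theorem IsConsensusSolution.exists_tendsto (hw : ∀ i j, 0 ≤ w i j) {E : ι → ι → Prop}
    (hE : ∀ i j, E i j → 0 < w i j) {r : ι} (hr : ∀ i, Relation.ReflTransGen E i r)
    (h : IsConsensusSolution w y 0) :
    ∃ ystar : ℝ, ∀ i, Tendsto (fun t => y t i) atTop (nhds ystar) := by
  obtain ⟨T, ε, hT, hε, hε1, H⟩ := exists_uniform_gain hw hE hr
  have : Nonempty ι := ⟨r⟩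
  obtain ⟨p, hp⟩ := Finite.exists_min (y 0)
  obtain ⟨q, hq⟩ := Finite.exists_max (y 0)
  have hcontract : ∀ k : ℕ, ∃ m M : ℝ, M - m = (1 - ε) ^ k * (y 0 q - y 0 p) ∧
      ∀ i, m ≤ y (k * T) i ∧ y (k * T) i ≤ M := by
    intro k
    induction k with
    | zero => exact ⟨y 0 p, y 0 q, by simp, fun i => by simpa using ⟨hp i, hq i⟩⟩
    | succ k ih =>
      obtain ⟨m, M, hD, hb⟩ := ih
      have hk : IsConsensusSolution w y (k * T) := h.mono (by positivity)
      have hlow := H y (k * T) m hk fun i => (hb i).1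
      have hup := H (fun t i => -y t i) (k * T) (-M) hk.neg fun i => neg_le_neg (hb i).2
      have htime : ((k + 1 : ℕ) : ℝ) * T = k * T + T := by
        push_cast
        ring
      refine ⟨m + ε * (y (k * T) r - m), M - ε * (M - y (k * T) r), ?_, fun i => ?_⟩
      · rw [pow_succ, mul_right_comm, ← hD]
        ring
      · rw [htime]
        exact ⟨hlow i, by linarith [hup i]⟩
  have hclose : ∀ δ : ℝ, 0 < δ → ∃ t₀ : ℝ, ∀ t t', t₀ ≤ t → t₀ ≤ t' → ∀ i j,
      dist (y t i) (y t' j) < δ := by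
    intro δ hδ
    have hlim : Tendsto (fun k : ℕ => (1 - ε) ^ k * (y 0 q - y 0 p)) atTop (nhds 0) := by
      simpa using (tendsto_pow_atTop_nhds_zero_of_lt_one (by linarith)
        (by linarith : 1 - ε < 1)).mul_const (y 0 q - y 0 p)
    obtain ⟨k, hk⟩ := (hlim.eventually_lt_const hδ).exists
    obtain ⟨m, M, hD, hb⟩ := hcontract k
    have hsol : IsConsensusSolution w y (k * T) := h.mono (by positivity)
    have hlow : ∀ t, k * T ≤ t → ∀ i, m ≤ y t i :=
      fun t ht i => hsol.le_of_le hw (fun j => (hb j).1) ht i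
    have hup : ∀ t, k * T ≤ t → ∀ i, y t i ≤ M := fun t ht i =>
      neg_le_neg_iff.1 (hsol.neg.le_of_le hw (fun j => neg_le_neg (hb j).2) ht i)
    refine ⟨k * T, fun t t' ht ht' i j => ?_⟩
    rw [Real.dist_eq, abs_lt]
    constructor <;> linarith [hlow t ht i, hlow t' ht' j, hup t ht i, hup t' ht' j]
  have hcauchy : CauchySeq fun t => y t r := Metric.cauchySeq_iff.2 fun δ hδ => by
    obtain ⟨t₀, ht₀⟩ := hclose δ hδ
    exact ⟨t₀, fun t ht t' ht' => ht₀ t t' ht ht' r r⟩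
  obtain ⟨ystar, hstar⟩ := cauchySeq_tendsto_of_complete hcauchy
  refine ⟨ystar, fun i => (tendsto_iff_of_dist ?_).1 hstar⟩
  refine Metric.tendsto_atTop.2 fun δ hδ => ?_
  obtain ⟨t₀, ht₀⟩ := hclose δ hδ
  refine ⟨t₀, fun t ht => ?_⟩
  rw [Real.dist_0_eq_abs, abs_of_nonneg dist_nonneg]
  exact ht₀ t t ht ht r i

end Consensus

/-- if the digraph (no self-loops, positive weights) contains a reverse
directed spanning tree, then every solution of the linear consensus dynamics
`ẋ_i = Σ_{j∈N_i} a_{ij}(x_j - x_i)` on `[0,∞)` converges to a common point `x*`. -/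
theorem linear_consensus_rendezvous {n : ℕ}
    (Adj : Fin n → Fin n → Bool) (hloop : ∀ i, Adj i i = false)
    (a : Fin n → Fin n → ℝ) (ha : ∀ i j, Adj i j = true → 0 < a i j)
    (htree : ∃ r : Fin n, ∀ i, Relation.ReflTransGen (fun p q => Adj p q = true) i r)
    (x : ℝ → Fin n → Fin 2 → ℝ)
    (hx : ∀ t : ℝ, 0 ≤ t → ∀ i,
      HasDerivWithinAt (fun s => x s i) (fcons Adj a (x t) i) (Set.Ici 0) t) :
    ∃ xstar : Fin 2 → ℝ, ∀ i,
      Filter.Tendsto (fun t => x t i) Filter.atTop (nhds xstar) := by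
  obtain ⟨r, hr⟩ := htree
  have hw : ∀ i j, 0 ≤ if Adj i j = true then a i j else 0 := by
    intro i j
    split_ifs with hij
    exacts [(ha i j hij).le, le_rfl]
  have hE : ∀ i j, Adj i j = true → 0 < if Adj i j = true then a i j else 0 := by
    intro i j hij
    rw [if_pos hij]
    exact ha i j hij
  have hcoord : ∀ d : Fin 2, ∃ ystar : ℝ, ∀ i,
      Filter.Tendsto (fun t => x t i d) Filter.atTop (nhds ystar) := by
    intro d
    refine IsConsensusSolution.exists_tendsto (y := fun t i => x t i d) hw hE hr ?_
    intro t ht i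
    refine (hasDerivWithinAt_pi.1 (hx t ht i) d).congr_deriv ?_
    rw [fcons, Finset.sum_apply]
    refine Finset.sum_congr rfl fun j _ => ?_
    by_cases hij : Adj i j = true <;> simp [hij]
  choose xstar hstar using hcoord
  exact ⟨xstar, fun i => tendsto_pi_nhds.2 fun d => hstar d i⟩
end

section
/- Let G be a strongly connected digraph on n vertices with no self-loops, with weights a_{ij} > 0 and weighted Laplacian L. Then the left kernel {γ ∈ ℝⁿ : γᵀ L = 0} of L is one-dimensional, and it is spanned by a vector γ all of whose entries are strictly positive. -/
open scoped BigOperators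

section LeftKernel

variable {n : ℕ} {Adj : Fin n → Fin n → Bool} {a : Fin n → Fin n → ℝ} {v : Fin n → ℝ}

/-- A vector is in the left kernel iff at each vertex its weighted outflow equals its inflow. -/
lemma vecMul_lap_eq_zero_iff :
    Matrix.vecMul v (lap Adj a) = 0 ↔
      ∀ j, v j * (∑ k, if Adj j k = true then a j k else 0) =
        ∑ i, v i * (if Adj i j = true then a i j else 0) := by
  rw [funext_iff]
  refine forall_congr' fun j => ?_
  rw [lap, Matrix.vecMul_sub, Pi.sub_apply, Matrix.vecMul_diagonal, Pi.zero_apply, sub_eq_zero]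
  rfl

lemma lap_mulVec_one : Matrix.mulVec (lap Adj a) 1 = 0 := by
  ext i
  rw [lap, Matrix.sub_mulVec, Pi.sub_apply, Matrix.mulVec_diagonal]
  simp [Matrix.mulVec, dotProduct]

lemma exists_ne_zero_vecMul_lap_eq_zero (hn : 0 < n) :
    ∃ v : Fin n → ℝ, v ≠ 0 ∧ Matrix.vecMul v (lap Adj a) = 0 := by
  rw [Matrix.exists_vecMul_eq_zero_iff, ← Matrix.exists_mulVec_eq_zero_iff]
  exact ⟨1, fun h => one_ne_zero (congrFun h ⟨0, hn⟩), lap_mulVec_one⟩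

lemma weight_nonneg (ha : ∀ i j, Adj i j = true → 0 < a i j) (i j : Fin n) :
    0 ≤ if Adj i j = true then a i j else 0 := by
  split_ifs with h
  exacts [(ha i j h).le, le_rfl]

/-- The left kernel of the Laplacian is closed under entrywise absolute value. -/
lemma vecMul_abs_lap_eq_zero (ha : ∀ i j, Adj i j = true → 0 < a i j)
    (hv : Matrix.vecMul v (lap Adj a) = 0) :
    Matrix.vecMul (fun i => |v i|) (lap Adj a) = 0 := by
  rw [vecMul_lap_eq_zero_iff] at hv ⊢
  have hle : ∀ j ∈ Finset.univ, |v j| * (∑ k, if Adj j k = true then a j k else 0) ≤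
      ∑ i, |v i| * (if Adj i j = true then a i j else 0) := by
    intro j _
    rw [← abs_of_nonneg (Finset.sum_nonneg fun k _ => weight_nonneg ha j k), ← abs_mul, hv j]
    refine (Finset.abs_sum_le_sum_abs _ _).trans_eq (Finset.sum_congr rfl fun i _ => ?_)
    rw [abs_mul, abs_of_nonneg (weight_nonneg ha i j)]
  have hsum : ∑ j, |v j| * (∑ k, if Adj j k = true then a j k else 0) =
      ∑ j, ∑ i, |v i| * (if Adj i j = true then a i j else 0) := by
    rw [Finset.sum_comm]
    simp_rw [Finset.mul_sum]
  exact fun j => (Finset.sum_eq_sum_iff_of_le hle).1 hsum j (Finset.mem_univ j)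

/-- In the strongly connected case, a left kernel vector with a zero entry vanishes. -/
lemma eq_zero_of_vecMul_lap_eq_zero
    (hsc : ∀ i j : Fin n, Relation.ReflTransGen (fun p q => Adj p q = true) i j)
    (ha : ∀ i j, Adj i j = true → 0 < a i j)
    (hv : Matrix.vecMul v (lap Adj a) = 0) {j : Fin n} (hj : v j = 0) : v = 0 := by
  have habs := vecMul_lap_eq_zero_iff.1 (vecMul_abs_lap_eq_zero ha hv)
  ext i
  induction hsc i j using Relation.ReflTransGen.head_induction_on with
  | refl => exact hj
  | @head p q hpq _ hq =>
    have hsum := habs q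
    rw [hq, Pi.zero_apply, abs_zero, zero_mul, eq_comm, Finset.sum_eq_zero_iff_of_nonneg
      fun i _ => mul_nonneg (abs_nonneg _) (weight_nonneg ha i q)] at hsum
    have hp := hsum p (Finset.mem_univ p)
    rw [if_pos hpq] at hp
    exact abs_eq_zero.1 ((mul_eq_zero.1 hp).resolve_right (ha p q hpq).ne')

end LeftKernel

/-- for a strongly connected digraph (no self-loops, positive weights),
the left kernel `{γ : γᵀL = 0}` of the weighted Laplacian is one-dimensional and
spanned by a vector with strictly positive entries. -/
theorem left_kernel_positive_vector {n : ℕ} (hn : 0 < n)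
    (Adj : Fin n → Fin n → Bool) (hloop : ∀ i, Adj i i = false)
    (hsc : ∀ i j : Fin n, Relation.ReflTransGen (fun p q => Adj p q = true) i j)
    (a : Fin n → Fin n → ℝ) (ha : ∀ i j, Adj i j = true → 0 < a i j) :
    ∃ γ : Fin n → ℝ, (∀ i, 0 < γ i) ∧
      {v : Fin n → ℝ | Matrix.vecMul v (lap Adj a) = 0} =
        ↑(Submodule.span ℝ {γ}) ∧
      Module.finrank ℝ ↥(Submodule.span ℝ {γ}) = 1 := by
  obtain ⟨v, hv0, hv⟩ := exists_ne_zero_vecMul_lap_eq_zero (Adj := Adj) (a := a) hn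
  have hpos : ∀ i, 0 < |v i| := fun i =>
    abs_pos.2 fun hi => hv0 (eq_zero_of_vecMul_lap_eq_zero hsc ha hv hi)
  have hγ := vecMul_abs_lap_eq_zero ha hv
  refine ⟨fun i => |v i|, hpos, ?_, finrank_span_singleton fun h =>
    (hpos ⟨0, hn⟩).ne' (congrFun h ⟨0, hn⟩)⟩
  ext u
  rw [Set.mem_ofPred_eq, SetLike.mem_coe, Submodule.mem_span_singleton]
  constructor
  · intro hu
    let i₀ : Fin n := ⟨0, hn⟩
    refine ⟨u i₀ / |v i₀|, (sub_eq_zero.1 ?_).symm⟩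
    refine eq_zero_of_vecMul_lap_eq_zero hsc ha (j := i₀) ?_ ?_
    · rw [Matrix.sub_vecMul, Matrix.smul_vecMul, hu, hγ, smul_zero, sub_zero]
    · simp [div_mul_cancel₀ _ (hpos i₀).ne']
  · rintro ⟨c, rfl⟩
    rw [Matrix.smul_vecMul, hγ, smul_zero]
end

section
/- Let c > 0 and M ≥ 0 be real constants, and let w : [0,∞) → ℝ be a differentiable function with w(t) ≥ 0 and w'(t) ≤ −c·w(t)² + M for all t ≥ 0. Then w is bounded; in fact w(t) ≤ max{ w(0), √(M/c) } for all t ≥ 0. -/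
/-- if `c > 0`, `M ≥ 0` and `w : [0,∞) → ℝ` is differentiable with
`w(t) ≥ 0` and `w'(t) ≤ -c w(t)² + M` for all `t ≥ 0`, then
`w(t) ≤ max (w 0) (√(M/c))` for all `t ≥ 0`. -/
theorem bounded_by_riccati (c M : ℝ) (hc : 0 < c) (hM : 0 ≤ M)
    (w w' : ℝ → ℝ)
    (hw_nonneg : ∀ t ∈ Set.Ici (0 : ℝ), 0 ≤ w t)
    (hw_deriv : ∀ t ∈ Set.Ici (0 : ℝ), HasDerivWithinAt w (w' t) (Set.Ici 0) t)
    (hw_ineq : ∀ t ∈ Set.Ici (0 : ℝ), w' t ≤ -c * w t ^ 2 + M) :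
    ∀ t ∈ Set.Ici (0 : ℝ), w t ≤ max (w 0) (Real.sqrt (M / c)) := by
  intro t ht
  refine le_of_forall_pos_le_add fun ε hε => ?_
  set K := max (w 0) (Real.sqrt (M / c)) + ε with hK
  have hsqrt : Real.sqrt (M / c) < K := by
    linarith [le_max_right (w 0) (Real.sqrt (M / c))]
  have hMK : M < c * K ^ 2 := by
    have h := (Real.sqrt_lt' ((Real.sqrt_nonneg _).trans_lt hsqrt)).1 hsqrt
    rwa [div_lt_iff₀' hc] at h
  refine image_le_of_deriv_right_lt_deriv_boundary (f := w) (f' := w') (a := 0) (b := t)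
    (B := fun _ => K) (B' := fun _ => 0)
    (fun x hx => (hw_deriv x hx.1).continuousWithinAt.mono Set.Icc_subset_Ici_self)
    (fun x hx => (hw_deriv x hx.1).mono (Set.Ici_subset_Ici.2 hx.1))
    (by linarith [le_max_left (w 0) (Real.sqrt (M / c))])
    (fun x => hasDerivAt_const x K) (fun x hx hxK => ?_) (Set.right_mem_Icc.2 ht)
  have h := hw_ineq x hx.1
  rw [hxK] at h
  linarith
end

section
/- Let G be a digraph on a finite vertex set V possessing a globally reachable vertex r (i ⇝ r for every i ∈ V), and suppose G has at least two strongly connected components. Then there exists a strongly connected component C different from the component [r] of r such that: (a) there is at least one edge from a vertex of C to a vertex of [r]; and (b) every edge from a vertex of C to a vertex outside C ends at a vertex of [r]. (In the condensation digraph, the root [r] is the only out-neighbor of the node corresponding to C.) -/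
/-- In a finite digraph, a nonempty set `S` of vertices has a vertex `c` that is reachable from
every vertex of `S` reachable from `c`. -/
theorem exists_reachability_terminal {V : Type*} [Finite V] (E : V → V → Prop) (S : Set V)
    (hS : S.Nonempty) :
    ∃ c ∈ S, ∀ q ∈ S, Relation.ReflTransGen E c q → Relation.ReflTransGen E q c := by
  let R : V → V → Prop := fun a b =>
    Relation.ReflTransGen E b a ∧ ¬ Relation.ReflTransGen E a b
  have : IsTrans V R := ⟨fun _ _ _ hab hbc =>
    ⟨hbc.1.trans hab.1, fun hac => hab.2 (hac.trans hbc.1)⟩⟩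
  have : Std.Irrefl R := ⟨fun _ h => h.2 h.1⟩
  obtain ⟨c, hc, hmin⟩ := (Finite.wellFounded_of_trans_of_irrefl R).has_min S hS
  exact ⟨c, hc, fun q hq hcq => by_contra fun hqc => hmin q hq ⟨hcq, hqc⟩⟩

/-- if `r` is globally reachable in a digraph on a finite vertex set
and the digraph has at least two strongly connected components, then there is a
strongly connected component `C` (the component of some vertex `c`), different from
the component of `r`, such that (a) some edge goes from `C` to the component of `r`,
and (b) every edge leaving `C` ends in the component of `r`. -/
theorem component_adjacent_to_root {V : Type*} [Fintype V] (E : V → V → Prop) (r : V)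
    (hr : ∀ i, Relation.ReflTransGen E i r)
    (h2 : ∃ v w : V, ¬(Relation.ReflTransGen E v w ∧ Relation.ReflTransGen E w v)) :
    ∃ c : V,
      ¬(Relation.ReflTransGen E c r ∧ Relation.ReflTransGen E r c) ∧
      (∃ p q : V, (Relation.ReflTransGen E c p ∧ Relation.ReflTransGen E p c) ∧
          (Relation.ReflTransGen E r q ∧ Relation.ReflTransGen E q r) ∧ E p q) ∧
      (∀ p q : V, (Relation.ReflTransGen E c p ∧ Relation.ReflTransGen E p c) →
          E p q → ¬(Relation.ReflTransGen E c q ∧ Relation.ReflTransGen E q c) →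
          (Relation.ReflTransGen E r q ∧ Relation.ReflTransGen E q r)) := by
  obtain ⟨c, hc, hterm⟩ :=
    exists_reachability_terminal E {x | ¬ Relation.ReflTransGen E r x} (by
      by_contra hS
      have hall : ∀ x, Relation.ReflTransGen E r x := fun x => by_contra fun hx => hS ⟨x, hx⟩
      obtain ⟨v, w, hvw⟩ := h2
      exact hvw ⟨(hr v).trans (hall w), (hr w).trans (hall v)⟩)
  refine ⟨c, fun h => hc h.2, ?_, fun p q hp hpq hq => ⟨?_, hr q⟩⟩
  · have key : ∀ x, Relation.ReflTransGen E x r →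
        Relation.ReflTransGen E c x ∧ Relation.ReflTransGen E x c →
        ∃ p q : V, (Relation.ReflTransGen E c p ∧ Relation.ReflTransGen E p c) ∧
          (Relation.ReflTransGen E r q ∧ Relation.ReflTransGen E q r) ∧ E p q := by
      intro x hx
      induction hx using Relation.ReflTransGen.head_induction_on with
      | refl => exact fun h => absurd h.2 hc
      | @head x y hxy _ ih =>
        intro h
        by_cases hy : Relation.ReflTransGen E r y
        · exact ⟨x, y, h, ⟨hy, hr y⟩, hxy⟩
        · have hcy := h.1.tail hxy
          exact ih ⟨hcy, hterm y hy hcy⟩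
    exact key c (hr c) ⟨.refl, .refl⟩
  · by_contra hrq
    have hcq := hp.1.tail hpq
    exact hq ⟨hcq, hterm q hrq hcq⟩
end
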